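/- Let d ≥ 2 and let V₁, V₂ ∈ V_d with Born approximations W₁, W₂. Then for every b ∈ (0,1): W₁ = W₂ almost everywhere on U_b if and only if V₁ = V₂ almost everywhere on U_b. -/

import Mathlib

open MeasureTheory Real Set
open scoped ENNReal NNReal

noncomputable section

/-- Euclidean space `ℝ^d`. -/
abbrev Edim (d : ℕ) := EuclideanSpace ℝ (Fin d)

/-- The open unit ball `B^d ⊂ ℝ^d`. -/
def unitBall (d : ℕ) : Set (Edim d) := Metric.ball 0 1

/-- `|S^{d-1}|`, the `(d-1)`-dimensional measure of the unit sphere, i.e. `d · ω_d`. -/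
def sphereArea (d : ℕ) : ℝ := d * (volume (Metric.ball (0 : Edim d) 1)).toReal

/-- The annulus `U_b = {x : b < |x| < 1}`. -/
def annulusU (d : ℕ) (b : ℝ) : Set (Edim d) := {x : Edim d | b < ‖x‖ ∧ ‖x‖ < 1}

/-- The `𝒱_d` norm:
`‖V‖_{𝒱_d} = sup_{j ∈ ℕ} ∫_{2^{-(j+1)} < |x| < 2^{-j}} |V(x)| |x|^{2-d} dx`, as an
extended real number. -/
def VdNorm (d : ℕ) (V : Edim d → ℝ) : ℝ≥0∞ :=
  ⨆ j : ℕ, ∫⁻ x in {x : Edim d | (2:ℝ) ^ (-(j:ℝ) - 1) < ‖x‖ ∧ ‖x‖ < (2:ℝ) ^ (-(j:ℝ))},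
    ENNReal.ofReal (|V x| * ‖x‖ ^ ((2:ℝ) - (d:ℝ)))

/-- The constant `β_V = (2/|S^{d-1}|) · max( √(6 |S^{d-1}| ‖V‖), 3e ‖V‖ )`. -/
def betaV (d : ℕ) (V : Edim d → ℝ) : ℝ :=
  (2 / sphereArea d) *
    max (Real.sqrt (6 * sphereArea d * (VdNorm d V).toReal))
      (3 * Real.exp 1 * (VdNorm d V).toReal)

/-- The constant `k_V = β_V - (d-2)/2`. -/
def kV (d : ℕ) (V : Edim d → ℝ) : ℝ := betaV d V - ((d:ℝ) - 2) / 2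

/-- `b`, with derivative `b'` on `(0,1]`, is a solution of the radial equation of degree `k`:
`b ∈ C¹((0,1])`, `r ↦ r^{d-1} b'(r)` is locally absolutely continuous on `(0,1]` (encoded
via a locally integrable density `g` together with the fundamental theorem of calculus), and
`-(r^{d-1}b'(r))'/r^{d-1} + (k(k+d-2)/r² + q(r)) b(r) = 0` for a.e. `r ∈ (0,1)`. -/
def IsRadialSolution (d : ℕ) (q : ℝ → ℝ) (k : ℕ) (b b' : ℝ → ℝ) : Prop :=
  (∀ r ∈ Set.Ioc (0:ℝ) 1, HasDerivWithinAt b (b' r) (Set.Ioc 0 1) r) ∧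
  ContinuousOn b' (Set.Ioc 0 1) ∧
  ∃ g : ℝ → ℝ, MeasureTheory.LocallyIntegrableOn g (Set.Ioc 0 1) ∧
    (∀ r₁ ∈ Set.Ioc (0:ℝ) 1, ∀ r₂ ∈ Set.Ioc (0:ℝ) 1, r₁ ≤ r₂ →
      r₂ ^ ((d:ℝ) - 1) * b' r₂ - r₁ ^ ((d:ℝ) - 1) * b' r₁ = ∫ t in r₁..r₂, g t) ∧
    (∀ᵐ r ∂(volume.restrict (Set.Ioo (0:ℝ) 1)),
      -(g r) / r ^ ((d:ℝ) - 1) + (((k:ℝ) * ((k:ℝ) + (d:ℝ) - 2)) / r ^ 2 + q r) * b r = 0)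

/-- The normalized solution of the radial equation of degree `k` from Lemma 2.1:
`b(1) = 1` together with the weighted square integrability `∫₀¹ |b(r)|² r^{d-2} dr < ∞`. -/
def IsDtNSolution (d : ℕ) (q : ℝ → ℝ) (k : ℕ) (b b' : ℝ → ℝ) : Prop :=
  IsRadialSolution d q k b b' ∧ b 1 = 1 ∧
    (∫⁻ r in Set.Ioo (0:ℝ) 1, ENNReal.ofReal ((b r) ^ 2 * r ^ ((d:ℝ) - 2))) < ⊤

/-- `lamk` is the generalized Dirichlet-to-Neumann eigenvalue `λ_k[V]` of the radial
potential with profile `q`: if there is a (necessarily unique) normalized solution `b_k` of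
the radial equation of degree `k` which is square integrable for the weight `r^{d-2}`, then
`λ_k[V] = b_k'(1)`; otherwise `λ_k[V] = k`. -/
def IsGenEigenvalue (d : ℕ) (q : ℝ → ℝ) (k : ℕ) (lamk : ℝ) : Prop :=
  (∃ b b' : ℝ → ℝ, (IsDtNSolution d q k b b' ∧
      ∀ c c' : ℝ → ℝ, IsDtNSolution d q k c c' → Set.EqOn c b (Set.Ioc 0 1)) ∧
      b' 1 = lamk) ∨
  (¬ (∃ b b' : ℝ → ℝ, IsDtNSolution d q k b b' ∧
      ∀ c c' : ℝ → ℝ, IsDtNSolution d q k c c' → Set.EqOn c b (Set.Ioc 0 1)) ∧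
    lamk = k)

/-- `W` is a Born approximation of the radial potential `V = q(|·|) ∈ 𝒱_d`: `W` is a radial
measurable function such that, for some integer `k₀ > k_V`, `∫_{B^d} |W(x)||x|^{2k₀} dx < ∞`
and `(1/|S^{d-1}|) ∫_{B^d} W(x) |x|^{2k} dx = λ_k[V] - k` for every integer `k ≥ k₀`. -/
def IsBornApprox (d : ℕ) (q : ℝ → ℝ) (W : Edim d → ℝ) : Prop :=
  Measurable W ∧ (∃ w : ℝ → ℝ, ∀ x, W x = w ‖x‖) ∧
  ∃ lam : ℕ → ℝ, (∀ k : ℕ, IsGenEigenvalue d q k (lam k)) ∧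
    ∃ k₀ : ℕ, kV d (fun x : Edim d => q ‖x‖) < (k₀:ℝ) ∧
      (∫⁻ x in unitBall d, ENNReal.ofReal (|W x| * ‖x‖ ^ (2 * k₀))) < ⊤ ∧
      ∀ k : ℕ, k₀ ≤ k →
        (sphereArea d)⁻¹ * ∫ x in unitBall d, W x * ‖x‖ ^ (2 * k) = lam k - (k:ℝ)


/-- Product rule (integrated form) for absolutely continuous functions. -/
lemma ac_prod_rule {a b : ℝ} (hab : a ≤ b) {A B α β : ℝ → ℝ}
    (hα : IntervalIntegrable α volume a b) (hβ : IntervalIntegrable β volume a b)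
    (hA : ∀ t ∈ Icc a b, A t = A a + ∫ s in a..t, α s)
    (hB : ∀ t ∈ Icc a b, B t = B a + ∫ s in a..t, β s) :
    A b * B b - A a * B a = ∫ t in a..b, (α t * B t + A t * β t) := by
  have hca : AbsolutelyContinuousOnInterval (fun _ : ℝ => A a) a b := by
    have := (LipschitzWith.const (α := ℝ) (A a)).lipschitzOnWith (s := uIcc a b)
    exact this.absolutelyContinuousOnInterval
  have hcb : AbsolutelyContinuousOnInterval (fun _ : ℝ => B a) a b := by
    have := (LipschitzWith.const (α := ℝ) (B a)).lipschitzOnWith (s := uIcc a b)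
    exact this.absolutelyContinuousOnInterval
  have h1 := hca.add (hα.absolutelyContinuousOnInterval_intervalIntegral (c := a) (by simp))
  have h2 := hcb.add (hβ.absolutelyContinuousOnInterval_intervalIntegral (c := a) (by simp))
  have h3 := h1.integral_deriv_mul_eq_sub h2
  have ea : A b = A a + ∫ s in a..b, α s := hA b ⟨hab, le_rfl⟩
  have eb : B b = B a + ∫ s in a..b, β s := hB b ⟨hab, le_rfl⟩
  simp only [Pi.add_apply, intervalIntegral.integral_same, add_zero] at h3
  rw [ea, eb, ← h3]
  apply intervalIntegral.integral_congr_ae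
  filter_upwards [hα.ae_hasDerivAt_integral, hβ.ae_hasDerivAt_integral] with x hx1 hx2 hx
  have hx' : x ∈ uIcc a b := uIoc_subset_uIcc hx
  have d1 := ((hx1 hx' a (by simp)).const_add (A a)).deriv
  have d2 := ((hx2 hx' a (by simp)).const_add (B a)).deriv
  have e1 : deriv ((fun _ : ℝ => A a) + fun x => ∫ v in a..x, α v) x = α x := d1
  have e2 : deriv ((fun _ : ℝ => B a) + fun x => ∫ v in a..x, β v) x = β x := d2
  rw [e1, e2]
  rw [uIcc_of_le hab] at hx'
  rw [hA x hx', hB x hx']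

/-- Gronwall uniqueness with an integrable coefficient. -/
lemma gronwall_zero {L : ℝ} (hL : 0 ≤ L) {φ k : ℝ → ℝ} (hφ : ContinuousOn φ (Icc 0 L))
    (hφ0 : ∀ t ∈ Icc 0 L, 0 ≤ φ t) (hk : IntervalIntegrable k volume 0 L)
    (hk0 : ∀ t ∈ Icc 0 L, 0 ≤ k t)
    (h : ∀ t ∈ Icc 0 L, φ t ≤ ∫ s in 0..t, k s * φ s) : ∀ t ∈ Icc 0 L, φ t = 0 := by
  have hcl : IsClosed ({t | φ t = 0} ∩ Icc 0 L) := by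
    have := hφ.preimage_isClosed_of_isClosed isClosed_Icc (isClosed_singleton (x := (0:ℝ)))
    rwa [inter_comm] at this
  have h0 : φ 0 = 0 := by
    have := h 0 ⟨le_rfl, hL⟩
    simp at this
    exact le_antisymm this (hφ0 0 ⟨le_rfl, hL⟩)
  refine hcl.Icc_subset_of_forall_mem_nhdsGT_of_Icc_subset h0 ?_
  intro t ht hsub
  have hkφ : IntervalIntegrable (fun s => k s * φ s) volume 0 L :=
    hk.mul_continuousOn (by rwa [uIcc_of_le hL])
  have hcont : ContinuousOn (fun x => ∫ s in t..x, k s) (Icc 0 L) := by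
    have := intervalIntegral.continuousOn_primitive_interval' hk (a := t)
      (by rw [uIcc_of_le hL]; exact ⟨ht.1, ht.2.le⟩)
    rwa [uIcc_of_le hL] at this
  have hev : ∀ᶠ x in nhdsWithin t (Ioi t), x < L ∧ ∫ s in t..x, k s < 1/2 := by
    have h1 : ContinuousWithinAt (fun x => ∫ s in t..x, k s) (Icc 0 L) t :=
      hcont t ⟨ht.1, ht.2.le⟩
    have h2 : ContinuousWithinAt (fun x => ∫ s in t..x, k s) (Ioo t L) t :=
      h1.mono (fun x hx => ⟨ht.1.trans hx.1.le, hx.2.le⟩)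
    rw [ContinuousWithinAt, nhdsWithin_Ioo_eq_nhdsGT ht.2] at h2
    simp only [intervalIntegral.integral_same] at h2
    have h3 := h2.eventually (gt_mem_nhds (by norm_num : (0:ℝ) < 1/2))
    have h4 : ∀ᶠ x in nhdsWithin t (Ioi t), x < L :=
      (nhdsWithin_le_nhds) (Iio_mem_nhds ht.2)
    filter_upwards [h3, h4] with x hx1 hx2 using ⟨hx2, hx1⟩
  filter_upwards [hev, self_mem_nhdsWithin] with x hx hxt
  simp only [mem_Ioi] at hxt
  have hsubs : Icc t x ⊆ Icc 0 L := Icc_subset_Icc ht.1 hx.1.le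
  obtain ⟨ξ, hξ, hmax⟩ := isCompact_Icc.exists_isMaxOn (nonempty_Icc.2 hxt.le) (hφ.mono hsubs)
  have hξL := hsubs hξ
  have i1 : IntervalIntegrable (fun s => k s * φ s) volume 0 t :=
    hkφ.mono_set (by rw [uIcc_of_le ht.1, uIcc_of_le hL]; exact Icc_subset_Icc le_rfl ht.2.le)
  have i2 : IntervalIntegrable (fun s => k s * φ s) volume t ξ :=
    hkφ.mono_set (by rw [uIcc_of_le hξ.1, uIcc_of_le hL]; exact Icc_subset_Icc ht.1 hξL.2)
  have i3 : IntervalIntegrable k volume t ξ :=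
    hk.mono_set (by rw [uIcc_of_le hξ.1, uIcc_of_le hL]; exact Icc_subset_Icc ht.1 hξL.2)
  have i4 : IntervalIntegrable k volume ξ x :=
    hk.mono_set (by rw [uIcc_of_le hξ.2, uIcc_of_le hL]; exact Icc_subset_Icc hξL.1 hx.1.le)
  have z : ∫ s in 0..t, k s * φ s = 0 := by
    rw [intervalIntegral.integral_congr (g := fun _ => (0:ℝ))]
    · simp
    · intro s hs
      rw [uIcc_of_le ht.1] at hs
      have := hsub hs
      have h0' : φ s = 0 := this
      simp [h0']
  have hb : φ ξ ≤ φ ξ * (1/2) := by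
    calc φ ξ ≤ ∫ s in 0..ξ, k s * φ s := h ξ hξL
      _ = ∫ s in t..ξ, k s * φ s := by
        rw [← intervalIntegral.integral_add_adjacent_intervals i1 i2, z, zero_add]
      _ ≤ ∫ s in t..ξ, k s * φ ξ := by
        apply intervalIntegral.integral_mono_on hξ.1 i2 (i3.mul_const _)
        intro s hs
        have hs' : s ∈ Icc t x := ⟨hs.1, hs.2.trans hξ.2⟩
        exact mul_le_mul_of_nonneg_left (hmax hs') (hk0 s (hsubs hs'))
      _ = φ ξ * ∫ s in t..ξ, k s := by rw [intervalIntegral.integral_mul_const]; ring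
      _ ≤ φ ξ * (1/2) := by
        apply mul_le_mul_of_nonneg_left _ (hφ0 ξ hξL)
        have e := intervalIntegral.integral_add_adjacent_intervals i3 i4
        have p : 0 ≤ ∫ s in ξ..x, k s := intervalIntegral.integral_nonneg hξ.2
          (fun s hs => hk0 s ⟨hξL.1.trans hs.1, hs.2.trans hx.1.le⟩)
        linarith [hx.2]
  have hxle : φ x ≤ φ ξ := hmax ⟨hxt.le, le_rfl⟩
  have := hφ0 x (hsubs ⟨hxt.le, le_rfl⟩)
  change φ x = 0
  linarith

/-- Vanishing moments (Phragmén / Lerch). -/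
lemma moments_zero {f : ℝ → ℝ} (hf : IntegrableOn f (Ioi 0))
    (h : ∀ n : ℕ, 1 ≤ n → ∫ t in Ioi (0:ℝ), f t * exp (-(2 * n * t)) = 0) :
    ∀ᵐ t ∂(volume.restrict (Ioi (0:ℝ))), f t = 0 := by
  -- Step 1
  have key : ∀ x : ℝ, ∀ n : ℕ, 1 ≤ n →
      ∫ t in Ioi (0:ℝ), f t * (1 - exp (-exp (2 * n * (x - t)))) = 0 := by
    intro x n hn
    let F : ℕ → ℝ → ℝ := fun j t => f t * (-((-exp (2 * n * (x - t))) ^ (j+1) / (j+1).factorial))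
    have hFi : ∀ j t, F j t = (-((-1) ^ (j+1) * exp (2 * n * x) ^ (j+1) / (j+1).factorial)) *
        (f t * exp (-(2 * ((n * (j+1) : ℕ) : ℝ) * t))) := by
      intro j t
      have : exp (2 * n * (x - t)) ^ (j+1) =
          exp (2 * n * x) ^ (j+1) * exp (-(2 * ((n * (j+1) : ℕ) : ℝ) * t)) := by
        rw [← Real.exp_nat_mul, ← Real.exp_nat_mul, ← Real.exp_add]
        congr 1; push_cast; ring
      simp only [F]
      rw [neg_pow, this]; ring
    have hintg : ∀ m : ℕ, IntegrableOn (fun t => f t * exp (-(2 * (m:ℝ) * t))) (Ioi 0) := by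
      intro m
      refine Integrable.mul_bdd (c := 1) hf (by fun_prop) ?_
      filter_upwards [self_mem_ae_restrict measurableSet_Ioi] with t ht
      simp only [mem_Ioi] at ht
      rw [Real.norm_eq_abs, abs_of_pos (exp_pos _)]
      apply Real.exp_le_one_iff.2
      have : 0 ≤ 2 * (m:ℝ) * t := by positivity
      linarith
    have hFint : ∀ j, Integrable (F j) (volume.restrict (Ioi 0)) := by
      intro j
      have : F j = fun t => _ := funext (hFi j)
      rw [this]
      exact (hintg (n * (j+1))).const_mul _
    have hFn : ∀ j, ∫ t in Ioi (0:ℝ), ‖F j t‖ ≤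
        (exp (2*n*x) ^ (j+1) / (j+1).factorial) * ∫ t in Ioi (0:ℝ), ‖f t‖ := by
      intro j
      rw [← integral_const_mul]
      apply setIntegral_mono_on (hFint j).norm (hf.norm.const_mul _) measurableSet_Ioi
      intro t ht
      simp only [mem_Ioi] at ht
      rw [hFi, norm_mul, norm_mul, norm_neg, norm_div, norm_mul, norm_pow, norm_pow, norm_neg]
      simp only [norm_one, one_pow, one_mul, Real.norm_eq_abs, Nat.abs_cast]
      rw [abs_of_pos (exp_pos _), abs_of_pos (exp_pos _)]
      apply mul_le_mul_of_nonneg_left _ (by positivity)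
      apply mul_le_of_le_one_right (abs_nonneg _)
      apply Real.exp_le_one_iff.2
      have : 0 ≤ 2 * ((n*(j+1) : ℕ):ℝ) * t := by positivity
      linarith
    have hsum : Summable (fun j => ∫ t in Ioi (0:ℝ), ‖F j t‖) := by
      refine Summable.of_nonneg_of_le (fun j => integral_nonneg (fun _ => norm_nonneg _)) hFn ?_
      apply Summable.mul_right
      exact (summable_nat_add_iff 1).2 (Real.summable_pow_div_factorial (exp (2*n*x)))
    have hS := hasSum_integral_of_summable_integral_norm hFint hsum
    have hz : ∀ j, ∫ t in Ioi (0:ℝ), F j t = 0 := by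
      intro j
      simp_rw [hFi]
      rw [integral_const_mul, h (n * (j+1)) (Nat.mul_pos hn (Nat.succ_pos j)), mul_zero]
    simp_rw [hz] at hS
    refine Eq.trans ?_ (hS.unique hasSum_zero)
    refine integral_congr_ae (Filter.Eventually.of_forall fun t => ?_)
    simp only [F]
    rw [tsum_mul_left]
    congr 1
    rw [tsum_neg]
    have e : HasSum (fun j : ℕ => (-exp (2 * n * (x - t))) ^ j / (j.factorial : ℝ))
        (exp (-exp (2 * n * (x - t)))) := by
      have e0 : ∀ z : ℝ, HasSum (fun j : ℕ => z ^ j / (j.factorial : ℝ)) (exp z) := fun z => by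
        rw [Real.exp_eq_exp_ℝ]; exact NormedSpace.expSeries_div_hasSum_exp z
      exact e0 _
    have e2 := (hasSum_nat_add_iff' 1).2 e
    simp at e2
    rw [e2.tsum_eq]; ring
  have key2 : ∀ x : ℝ, 0 < x → ∫ t in (0:ℝ)..x, f t = 0 := by
    intro x hx
    have hlim : Filter.Tendsto (fun n : ℕ => ∫ t in Ioi (0:ℝ),
        f t * (1 - exp (-exp (2 * (n+1 : ℕ) * (x - t))))) Filter.atTop
        (nhds (∫ t in Ioi (0:ℝ), (Ioo 0 x).indicator f t)) := by
      apply tendsto_integral_of_dominated_convergence (fun t => ‖f t‖)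
      · intro n
        exact hf.aestronglyMeasurable.mul (by fun_prop)
      · exact hf.norm
      · intro n
        filter_upwards with t
        rw [norm_mul]
        apply mul_le_of_le_one_right (norm_nonneg _)
        rw [Real.norm_eq_abs, abs_le]
        have h1 := exp_pos (-exp (2 * ((n+1:ℕ):ℝ) * (x - t)))
        have h2 : exp (-exp (2 * ((n+1:ℕ):ℝ) * (x - t))) ≤ 1 :=
          Real.exp_le_one_iff.2 (by linarith [exp_pos (2 * ((n+1:ℕ):ℝ) * (x - t))])
        constructor <;> linarith
      · have hne : ∀ᵐ t ∂(volume.restrict (Ioi (0:ℝ))), t ≠ x :=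
          ae_restrict_of_ae (by simp [ae_iff, measure_singleton])
        filter_upwards [hne, self_mem_ae_restrict measurableSet_Ioi] with t hne ht
        simp only [mem_Ioi] at ht
        have hn : Filter.Tendsto (fun n : ℕ => ((n + 1 : ℕ) : ℝ)) Filter.atTop Filter.atTop :=
          tendsto_natCast_atTop_atTop.comp (Filter.tendsto_add_atTop_nat 1)
        rcases lt_or_gt_of_ne hne with hlt | hgt
        · rw [indicator_of_mem (show t ∈ Ioo 0 x from ⟨ht, hlt⟩)]
          have h1 : Filter.Tendsto (fun n : ℕ => 2 * ((n + 1 : ℕ) : ℝ) * (x - t)) Filter.atTop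
              Filter.atTop := (hn.const_mul_atTop (by norm_num)).atTop_mul_const (by linarith)
          have h2 := Real.tendsto_exp_neg_atTop_nhds_zero.comp (Real.tendsto_exp_atTop.comp h1)
          have h3 := (h2.const_sub 1).const_mul (f t)
          simpa using h3
        · rw [indicator_of_notMem (fun hh => absurd hh.2 (not_lt.2 hgt.le))]
          have h1 : Filter.Tendsto (fun n : ℕ => 2 * ((n + 1 : ℕ) : ℝ) * (x - t)) Filter.atTop
              Filter.atBot := (hn.const_mul_atTop (by norm_num)).atTop_mul_const_of_neg (by linarith)
          have h2 := (Real.tendsto_exp_atBot.comp h1).neg.rexp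
          have h3 := (h2.const_sub 1).const_mul (f t)
          simpa using h3
    have hz : (fun n : ℕ => ∫ t in Ioi (0:ℝ),
        f t * (1 - exp (-exp (2 * (n+1 : ℕ) * (x - t))))) = fun _ => 0 := by
      ext n; exact key x (n+1) (Nat.succ_pos n)
    rw [hz] at hlim
    have := tendsto_nhds_unique hlim tendsto_const_nhds
    rw [intervalIntegral.integral_of_le hx.le, integral_Ioc_eq_integral_Ioo]
    rw [setIntegral_indicator measurableSet_Ioo] at this
    rwa [inter_eq_self_of_subset_right (fun t ht => ht.1)] at this
  let g := (Ioi (0:ℝ)).indicator f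
  have hg : Integrable g := (integrable_indicator_iff measurableSet_Ioi).2 hf
  have hd := LocallyIntegrable.ae_hasDerivAt_integral hg.locallyIntegrable
  rw [ae_restrict_iff' measurableSet_Ioi]
  filter_upwards [hd] with x hx hx0
  simp only [mem_Ioi] at hx0
  have h1 := hx 0
  have h2 : HasDerivAt (fun x => ∫ t in (0:ℝ)..x, g t) 0 x := by
    refine (hasDerivAt_const x (0:ℝ)).congr_of_eventuallyEq ?_
    filter_upwards [Ioi_mem_nhds hx0] with y hy
    simp only [mem_Ioi] at hy
    refine Eq.trans ?_ (key2 y hy)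
    rw [intervalIntegral.integral_of_le hy.le, intervalIntegral.integral_of_le hy.le]
    apply setIntegral_congr_fun measurableSet_Ioc
    intro t ht
    exact indicator_of_mem (show t ∈ Ioi (0:ℝ) from ht.1) f
  have h3 := h1.unique h2
  rwa [show g x = f x from indicator_of_mem (show x ∈ Ioi (0:ℝ) from hx0) f] at h3

/-- Shear change of variables on the quadrant. -/
lemma shear {Φ : ℝ → ℝ → ℝ}
    (hΦ : Integrable (Function.uncurry Φ)
      ((volume.restrict (Ioi (0:ℝ))).prod (volume.restrict (Ioi (0:ℝ))))) :
    IntegrableOn (fun y => ∫ τ in (0:ℝ)..y, Φ τ (y - τ)) (Ioi 0) ∧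
    ∫ y in Ioi (0:ℝ), ∫ τ in (0:ℝ)..y, Φ τ (y - τ) =
      ∫ τ in Ioi (0:ℝ), ∫ z in Ioi (0:ℝ), Φ τ z := by
  let Ψ : ℝ × ℝ → ℝ := (Ioi (0:ℝ) ×ˢ Ioi (0:ℝ)).indicator (Function.uncurry Φ)
  have hms : MeasurableSet (Ioi (0:ℝ) ×ˢ Ioi (0:ℝ)) := measurableSet_Ioi.prod measurableSet_Ioi
  have hΨ : Integrable Ψ (volume.prod volume) := by
    rw [Measure.prod_restrict] at hΦ
    exact (integrable_indicator_iff hms).2 hΦ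
  have hmp := measurePreserving_prod_sub_swap (G := ℝ) (volume) (volume)
  have hΨ2 : Integrable (fun z : ℝ × ℝ => Ψ (z.2, z.1 - z.2)) (volume.prod volume) :=
    hmp.integrable_comp_of_integrable hΨ
  have hin : ∀ y, ∫ τ, Ψ (τ, y - τ) = (Ioi (0:ℝ)).indicator
      (fun y => ∫ τ in (0:ℝ)..y, Φ τ (y - τ)) y := by
    intro y
    have e : ∀ τ, Ψ (τ, y - τ) = (Ioo 0 y).indicator (fun τ => Φ τ (y - τ)) τ := by
      intro τ
      simp only [Ψ, indicator, mem_prod, mem_Ioi, mem_Ioo, sub_pos, Function.uncurry]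
    simp_rw [e]
    rw [integral_indicator measurableSet_Ioo]
    by_cases hy : 0 < y
    · rw [indicator_of_mem (show y ∈ Ioi (0:ℝ) from hy), intervalIntegral.integral_of_le hy.le,
        integral_Ioc_eq_integral_Ioo]
    · rw [indicator_of_notMem (show y ∉ Ioi (0:ℝ) from hy), Ioo_eq_empty hy]
      simp
  constructor
  · have := hΨ2.integral_prod_left
    simp only [hin] at this
    exact (integrable_indicator_iff measurableSet_Ioi).1 this
  · have e1 : ∫ y in Ioi (0:ℝ), (∫ τ in (0:ℝ)..y, Φ τ (y - τ))
        = ∫ z, Ψ (z.2, z.1 - z.2) ∂(volume.prod volume) := by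
      rw [integral_prod _ hΨ2, ← integral_indicator measurableSet_Ioi]
      simp only [hin]
    have e2 : ∫ z, Ψ (z.2, z.1 - z.2) ∂(volume.prod volume) = ∫ z, Ψ z ∂(volume.prod volume) := by
      have := integral_map (μ := (volume : Measure ℝ).prod volume) (f := Ψ) hmp.measurable.aemeasurable
        (by rw [hmp.map_eq]; exact hΨ.aestronglyMeasurable)
      rw [hmp.map_eq] at this
      exact this.symm
    have e3 := integral_prod _ hΦ
    rw [Measure.prod_restrict, ← integral_indicator hms] at e3
    exact (e1.trans e2).trans e3


/-- Uniform local integrability of the potential in logarithmic variables. -/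
structure ULQ (Q : ℝ → ℝ) (C : ℝ) : Prop where
  meas : Measurable Q
  loc : ∀ a b : ℝ, IntervalIntegrable Q volume a b
  C0 : 0 ≤ C
  bd : ∀ x : ℝ, 0 ≤ x → ∫ s in (0:ℝ)..x, exp s * |Q s| ≤ C * exp x

def Nf (Q : ℝ → ℝ) (φ : ℝ × ℝ → ℝ) (x z : ℝ) : ℝ := ∫ s in (0:ℝ)..x, Q s * exp s * φ (s, z)

lemma ULQ.int_exp {Q : ℝ → ℝ} {C : ℝ} (h : ULQ Q C) (a b : ℝ) :
    IntervalIntegrable (fun s => Q s * exp s) volume a b :=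
  (h.loc a b).mul_continuousOn (by fun_prop)

lemma ULQ.int_cont {Q : ℝ → ℝ} {C : ℝ} (h : ULQ Q C) {f : ℝ → ℝ} (hf : Continuous f) (a b : ℝ) :
    IntervalIntegrable (fun s => Q s * f s) volume a b :=
  (h.loc a b).mul_continuousOn hf.continuousOn

lemma Nf_cont {Q : ℝ → ℝ} {C : ℝ} (h : ULQ Q C) {φ : ℝ × ℝ → ℝ} (hφ : Continuous φ) {R : ℝ}
    (hR : ∀ p, |φ p| ≤ R) : Continuous (fun p : ℝ × ℝ => Nf Q φ p.1 p.2) := by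
  have key : Continuous (fun p : ℝ × ℝ => Nf Q φ p.2 p.1) := by
    rw [continuous_iff_continuousAt]
    rintro ⟨z₀, x₀⟩
    have := intervalIntegral.continuousAt_parametric_primitive_of_dominated (μ := volume)
      (F := fun z s => Q s * exp s * φ (s, z)) (fun s => |Q s * exp s| * R)
      (min 0 x₀ - 1) (max 0 x₀ + 1) (a₀ := 0) (b₀ := x₀) (x₀ := z₀) ?_ ?_ ?_ ?_ ?_ ?_ ?_
    · exact this
    · intro z
      have := h.meas
      have hm : Measurable fun s => Q s * exp s * φ (s, z) := by
        have : Measurable fun s => φ (s, z) := by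
          apply Continuous.measurable; fun_prop
        have h2 := h.meas
        fun_prop
      exact hm.aestronglyMeasurable
    · filter_upwards with z
      filter_upwards with s
      rw [norm_mul]
      exact mul_le_mul_of_nonneg_left (hR _) (norm_nonneg _)
    · exact ((h.int_exp _ _).norm).mul_const R
    · filter_upwards with s
      fun_prop
    · constructor
      · have := min_le_left 0 x₀; linarith
      · have := le_max_left 0 x₀; linarith
    · constructor
      · have := min_le_right 0 x₀; linarith
      · have := le_max_right 0 x₀; linarith
    · simp
  exact key.comp continuous_swap

lemma abs_int_le {f g : ℝ → ℝ} {a b : ℝ} (hab : a ≤ b) (h : ∀ᵐ s, s ∈ Ioc a b → ‖f s‖ ≤ g s)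
    (hg : IntervalIntegrable g volume a b) : |∫ s in a..b, f s| ≤ ∫ s in a..b, g s :=
  intervalIntegral.norm_integral_le_of_norm_le hab h hg

lemma Nf_bound {Q : ℝ → ℝ} {C : ℝ} (h : ULQ Q C) {φ : ℝ × ℝ → ℝ} {R : ℝ}
    (hR : ∀ p, |φ p| ≤ R) {x : ℝ} (hx : 0 ≤ x) (z : ℝ) : |Nf Q φ x z| ≤ R * C * exp x := by
  have h1 : |Nf Q φ x z| ≤ ∫ s in (0:ℝ)..x, (exp s * |Q s|) * R := by
    refine abs_int_le hx ?_ ?_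
    · filter_upwards with s hs
      rw [norm_mul, norm_mul, Real.norm_eq_abs, Real.norm_eq_abs, Real.norm_eq_abs, abs_of_pos (exp_pos s), mul_comm |Q s|]
      exact mul_le_mul_of_nonneg_left (hR _) (by positivity)
    · exact (((h.loc _ _).abs).continuousOn_mul (by fun_prop)).mul_const R
  rw [intervalIntegral.integral_mul_const] at h1
  have hR0 : 0 ≤ R := (abs_nonneg _).trans (hR (0,0))
  have := mul_le_mul_of_nonneg_right (h.bd x hx) hR0
  nlinarith

lemma Pf_bound {Q : ℝ → ℝ} {C : ℝ} (h : ULQ Q C) {x : ℝ} (hx : 0 ≤ x) :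
    |∫ s in (0:ℝ)..x, Q s| ≤ C * exp x := by
  refine le_trans ?_ (h.bd x hx)
  refine abs_int_le hx ?_ ?_
  · filter_upwards with s hs
    rw [Real.norm_eq_abs]
    have : 1 ≤ exp s := one_le_exp hs.1.le
    nlinarith [abs_nonneg (Q s)]
  · exact (((h.loc _ _).abs).continuousOn_mul (by fun_prop))

lemma Pf_cont {Q : ℝ → ℝ} {C : ℝ} (h : ULQ Q C) : Continuous fun x => ∫ s in (0:ℝ)..x, Q s :=
  intervalIntegral.continuous_primitive h.loc 0

def Bf (Q : ℝ → ℝ) (M : ℝ) (φ : ℝ × ℝ → ℝ) (t y : ℝ) : ℝ :=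
  ∫ τ in (0:ℝ)..y, exp (-(M * τ)) * (Nf Q φ (t + τ) (y - τ) - Nf Q φ τ (y - τ))

lemma Bf_cont {Q : ℝ → ℝ} {C : ℝ} (h : ULQ Q C) (M : ℝ) {φ : ℝ × ℝ → ℝ} (hφ : Continuous φ) {R : ℝ}
    (hR : ∀ p, |φ p| ≤ R) : Continuous (fun p : ℝ × ℝ => Bf Q M φ p.1 p.2) := by
  have hN := Nf_cont h hφ hR
  unfold Bf
  apply intervalIntegral.continuous_parametric_intervalIntegral_of_continuous
    (f := fun (p : ℝ × ℝ) τ => exp (-(M * τ)) * (Nf Q φ (p.1 + τ) (p.2 - τ) - Nf Q φ τ (p.2 - τ)))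
  · have e1 : Continuous fun w : (ℝ × ℝ) × ℝ => Nf Q φ (w.1.1 + w.2) (w.1.2 - w.2) :=
      hN.comp (f := fun w : (ℝ × ℝ) × ℝ => (w.1.1 + w.2, w.1.2 - w.2)) (by fun_prop)
    have e2 : Continuous fun w : (ℝ × ℝ) × ℝ => Nf Q φ (w.2) (w.1.2 - w.2) :=
      hN.comp (f := fun w : (ℝ × ℝ) × ℝ => (w.2, w.1.2 - w.2)) (by fun_prop)
    simp only [Function.uncurry_def]
    exact Continuous.mul (by fun_prop) (e1.sub e2)
  · fun_prop

lemma Bf_bound {Q : ℝ → ℝ} {C : ℝ} (h : ULQ Q C) {M : ℝ} (hM : 1 < M) {φ : ℝ × ℝ → ℝ} {R : ℝ}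
    (hR : ∀ p, |φ p| ≤ R) {t y : ℝ} (ht : 0 ≤ t) (hy : 0 ≤ y) :
    |Bf Q M φ t y| ≤ R * (2 * C / (M - 1)) * exp t := by
  have hR0 : 0 ≤ R := (abs_nonneg _).trans (hR (0,0))
  have h1 : |Bf Q M φ t y| ≤ ∫ τ in (0:ℝ)..y, (R * C * 2 * exp t) * exp (-((M-1) * τ)) := by
    refine abs_int_le hy ?_ ?_
    · filter_upwards with s hs
      rw [norm_mul, Real.norm_eq_abs, Real.norm_eq_abs, abs_of_pos (exp_pos _)]
      have a1 := Nf_bound h hR (x := t + s) (by linarith [hs.1]) (y - s)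
      have a2 := Nf_bound h hR (x := s) hs.1.le (y - s)
      have a3 : exp s ≤ exp (t + s) := exp_le_exp.2 (by linarith)
      have a4 : |Nf Q φ (t+s) (y-s) - Nf Q φ s (y-s)| ≤ R * C * 2 * exp (t+s) := by
        have := abs_sub (Nf Q φ (t+s) (y-s)) (Nf Q φ s (y-s))
        have := mul_le_mul_of_nonneg_left a3 (mul_nonneg hR0 h.C0)
        linarith
      calc _ ≤ exp (-(M*s)) * (R * C * 2 * exp (t+s)) := mul_le_mul_of_nonneg_left a4 (exp_pos _).le
        _ = _ := by
          have : exp (-((M-1)*s)) = exp (-(M*s)) * exp s := by rw [← exp_add]; ring_nf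
          rw [this, exp_add]; ring
    · exact Continuous.intervalIntegrable (by fun_prop) _ _
  have h2 : ∫ τ in (0:ℝ)..y, exp (-((M-1) * τ)) ≤ 1 / (M-1) := by
    have : ∫ τ in (0:ℝ)..y, exp (-((M-1) * τ)) = (1 - exp (-((M-1)*y))) / (M-1) := by
      have hd : ∀ x ∈ uIcc (0:ℝ) y, HasDerivAt (fun τ => -exp (-((M-1)*τ)) / (M-1)) (exp (-((M-1)*x))) x := by
        intro x _
        have : HasDerivAt (fun τ : ℝ => -((M-1)*τ)) (-((M-1)*1)) x := ((hasDerivAt_id x).const_mul _).neg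
        have h3 := (this.exp.neg).div_const (M-1)
        have h4 : M - 1 ≠ 0 := by linarith
        have h5 : -(rexp (-((M - 1) * x)) * -((M - 1) * 1)) / (M - 1) = exp (-((M-1)*x)) := by
          rw [div_eq_iff h4]; ring
        rw [h5] at h3
        exact h3
      rw [intervalIntegral.integral_eq_sub_of_hasDerivAt hd (Continuous.intervalIntegrable (by fun_prop) _ _)]
      simp; ring
    rw [this]
    apply div_le_div_of_nonneg_right _ (by linarith)
    linarith [exp_pos (-((M-1)*y))]
  rw [intervalIntegral.integral_const_mul] at h1
  refine h1.trans ((mul_le_mul_of_nonneg_left h2 ?_).trans (le_of_eq (by ring)))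
  have := h.C0
  positivity

lemma Nf_sub {Q : ℝ → ℝ} {C : ℝ} (h : ULQ Q C) {φ ψ : ℝ × ℝ → ℝ} (hφ : Continuous φ) (hψ : Continuous ψ)
    (x z : ℝ) : Nf Q φ x z - Nf Q ψ x z = Nf Q (fun p => φ p - ψ p) x z := by
  unfold Nf
  rw [← intervalIntegral.integral_sub]
  · congr 1; ext s; ring
  · exact (h.int_exp _ _).mul_continuousOn (by fun_prop)
  · exact (h.int_exp _ _).mul_continuousOn (by fun_prop)

lemma Bf_sub {Q : ℝ → ℝ} {C : ℝ} (h : ULQ Q C) (M : ℝ) {φ ψ : ℝ × ℝ → ℝ} (hφ : Continuous φ) (hψ : Continuous ψ)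
    {R S : ℝ} (hR : ∀ p, |φ p| ≤ R) (hS : ∀ p, |ψ p| ≤ S)
    (t y : ℝ) : Bf Q M φ t y - Bf Q M ψ t y = Bf Q M (fun p => φ p - ψ p) t y := by
  have hN : ∀ {φ : ℝ × ℝ → ℝ} {R : ℝ}, Continuous φ → (∀ p, |φ p| ≤ R) → IntervalIntegrable (fun τ =>
      exp (-(M * τ)) * (Nf Q φ (t + τ) (y - τ) - Nf Q φ τ (y - τ))) volume 0 y := by
    intro φ R hφ hR
    have hN := Nf_cont h hφ hR
    have e1 : Continuous fun w : ℝ => Nf Q φ (t + w) (y - w) :=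
      hN.comp (f := fun w : ℝ => (t + w, y - w)) (by fun_prop)
    have e2 : Continuous fun w : ℝ => Nf Q φ (w) (y - w) :=
      hN.comp (f := fun w : ℝ => (w, y - w)) (by fun_prop)
    exact (Continuous.mul (by fun_prop) (e1.sub e2)).intervalIntegrable _ _
  unfold Bf
  rw [← intervalIntegral.integral_sub (hN hφ hR) (hN hψ hS)]
  congr 1; ext s
  rw [← Nf_sub h hφ hψ, ← Nf_sub h hφ hψ]; ring

/-- Existence of the kernel. -/
lemma exists_kernel {Q : ℝ → ℝ} {C : ℝ} (h : ULQ Q C) :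
    ∃ (φ : ℝ × ℝ → ℝ) (R : ℝ), Continuous φ ∧ (∀ p, |φ p| ≤ R) ∧
      ∀ t y : ℝ, 0 ≤ t → 0 ≤ y → φ (t, y) = exp (-t) *
        (-(exp (-((2 + 4 * C) * y)) * ((∫ s in (0:ℝ)..(t+y), Q s) - ∫ s in (0:ℝ)..y, Q s))
          - Bf Q (2 + 4 * C) φ t y) := by
  set M := 2 + 4 * C with hMdef
  have hC := h.C0
  have hM : 1 < M := by linarith
  have hP := Pf_cont h
  let raw : (ℝ × ℝ → ℝ) → ℝ × ℝ → ℝ := fun φ p =>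
    exp (-(max p.1 0)) * (-(exp (-(M * max p.2 0)) * ((∫ s in (0:ℝ)..(max p.1 0 + max p.2 0), Q s)
      - ∫ s in (0:ℝ)..(max p.2 0), Q s)) - Bf Q M φ (max p.1 0) (max p.2 0))
  have raw_cont : ∀ (φ : ℝ × ℝ → ℝ) (R : ℝ), Continuous φ → (∀ p, |φ p| ≤ R) → Continuous (raw φ) := by
    intro φ R hφ hR
    have e1 : Continuous fun p : ℝ × ℝ => Bf Q M φ (max p.1 0) (max p.2 0) :=
      (Bf_cont h M hφ hR).comp (f := fun p : ℝ × ℝ => (max p.1 0, max p.2 0)) (by fun_prop)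
    have e2 : Continuous fun p : ℝ × ℝ => ∫ s in (0:ℝ)..(max p.1 0 + max p.2 0), Q s :=
      hP.comp (f := fun p : ℝ × ℝ => max p.1 0 + max p.2 0) (by fun_prop)
    have e3 : Continuous fun p : ℝ × ℝ => ∫ s in (0:ℝ)..(max p.2 0), Q s :=
      hP.comp (f := fun p : ℝ × ℝ => max p.2 0) (by fun_prop)
    simp only [raw]
    fun_prop
  have raw_bd : ∀ (φ : ℝ × ℝ → ℝ) (R : ℝ), (∀ p, |φ p| ≤ R) → ∀ p, |raw φ p| ≤ 2 * C + R * (2 * C / (M-1)) := by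
    intro φ R hR p
    simp only [raw]
    set t := max p.1 0
    set y := max p.2 0
    have ht : 0 ≤ t := le_max_right _ _
    have hy : 0 ≤ y := le_max_right _ _
    have b1 := Bf_bound h hM hR ht hy
    have b2 := Pf_bound h (x := t + y) (by linarith)
    have b3 := Pf_bound h hy
    have b4 : C * exp y ≤ C * exp (t + y) := mul_le_mul_of_nonneg_left (exp_le_exp.2 (by linarith)) hC
    rw [abs_mul, abs_of_pos (exp_pos _)]
    have b5 : |exp (-(M * y)) * ((∫ s in (0:ℝ)..(t + y), Q s) - ∫ s in (0:ℝ)..y, Q s)| ≤ 2 * C * exp t := by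
      rw [abs_mul, abs_of_pos (exp_pos _)]
      have := abs_sub (∫ s in (0:ℝ)..(t + y), Q s) (∫ s in (0:ℝ)..y, Q s)
      calc _ ≤ exp (-(M*y)) * (2 * C * exp (t+y)) := mul_le_mul_of_nonneg_left (by linarith) (exp_pos _).le
        _ = 2 * C * (exp (-(M * y)) * exp (t+y)) := by ring
        _ ≤ 2 * C * exp t := by
          rw [← exp_add]
          refine mul_le_mul_of_nonneg_left (exp_le_exp.2 ?_) (by linarith)
          nlinarith
    have b6 := abs_sub (-(exp (-(M * y)) * ((∫ s in (0:ℝ)..(t + y), Q s) - ∫ s in (0:ℝ)..y, Q s))) (Bf Q M φ t y)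
    rw [abs_neg] at b6
    calc _ ≤ exp (-t) * (2 * C * exp t + R * (2 * C / (M - 1)) * exp t) :=
          mul_le_mul_of_nonneg_left (by linarith) (exp_pos _).le
      _ = (2 * C + R * (2 * C / (M-1))) * (exp (-t) * exp t) := by ring
      _ = _ := by rw [← exp_add]; simp
  have hnb : ∀ (φ : BoundedContinuousFunction (ℝ × ℝ) ℝ) p, |φ p| ≤ ‖φ‖ := fun φ p => φ.norm_coe_le_norm p
  let T : BoundedContinuousFunction (ℝ × ℝ) ℝ → BoundedContinuousFunction (ℝ × ℝ) ℝ := fun φ =>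
    BoundedContinuousFunction.ofNormedAddCommGroup (raw φ) (raw_cont φ ‖φ‖ φ.continuous (hnb φ))
      (2 * C + ‖φ‖ * (2 * C / (M-1))) (raw_bd φ ‖φ‖ (hnb φ))
  have hT : ContractingWith (1/2 : ℝ≥0) T := by
    refine ⟨by rw [← NNReal.coe_lt_coe]; norm_num, LipschitzWith.of_dist_le_mul fun φ ψ => ?_⟩
    rw [BoundedContinuousFunction.dist_le (by positivity)]
    intro p
    simp only [T, BoundedContinuousFunction.coe_ofNormedAddCommGroup, raw]
    set t := max p.1 0
    set y := max p.2 0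
    have ht : 0 ≤ t := le_max_right _ _
    have hy : 0 ≤ y := le_max_right _ _
    have hd : ∀ p, |φ p - ψ p| ≤ dist φ ψ := fun p => by
      rw [← Real.dist_eq]; exact BoundedContinuousFunction.dist_coe_le_dist p
    have b1 := Bf_bound h hM hd ht hy
    rw [← Bf_sub h M φ.continuous ψ.continuous (hnb φ) (hnb ψ)] at b1
    rw [Real.dist_eq, ← mul_sub, abs_mul, abs_of_pos (exp_pos _)]
    have : ∀ a b c : ℝ, (a - b) - (a - c) = -(b - c) := fun a b c => by ring
    rw [this, abs_neg]
    have hf : 2 * C / (M-1) ≤ 1/2 := by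
      rw [div_le_div_iff₀ (by linarith) (by norm_num)]; linarith
    calc _ ≤ exp (-t) * (dist φ ψ * (2 * C / (M-1)) * exp t) := mul_le_mul_of_nonneg_left b1 (exp_pos _).le
      _ = dist φ ψ * (2 * C / (M-1)) * (exp (-t) * exp t) := by ring
      _ = dist φ ψ * (2 * C / (M-1)) := by rw [← exp_add]; simp
      _ ≤ dist φ ψ * (1/2) := mul_le_mul_of_nonneg_left hf dist_nonneg
      _ = _ := by push_cast; ring
  obtain ⟨φ, hφ⟩ : ∃ φ, T φ = φ := ⟨_, hT.fixedPoint_isFixedPt⟩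
  refine ⟨φ, ‖φ‖, φ.continuous, hnb φ, ?_⟩
  intro t y ht hy
  have := congrArg (fun f => f (t, y)) hφ
  simp only [T, BoundedContinuousFunction.coe_ofNormedAddCommGroup, raw, max_eq_left ht, max_eq_left hy] at this
  exact this.symm


/-- The data of a transformation kernel. -/
structure KerData (Q : ℝ → ℝ) (C M : ℝ) (φ : ℝ × ℝ → ℝ) (R : ℝ) : Prop where
  ul : ULQ Q C
  M1 : 1 < M
  cont : Continuous φ
  bd : ∀ p, |φ p| ≤ R
  eq : ∀ t y : ℝ, 0 ≤ t → 0 ≤ y → φ (t, y) = exp (-t) *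
        (-(exp (-(M * y)) * ((∫ s in (0:ℝ)..(t+y), Q s) - ∫ s in (0:ℝ)..y, Q s))
          - Bf Q M φ t y)

def gL (φ : ℝ × ℝ → ℝ) (m : ℝ) (t : ℝ) : ℝ := 1 + exp t * ∫ y in Ioi (0:ℝ), φ (t, y) * exp (-(m * y))

def rhoL (Q : ℝ → ℝ) (φ : ℝ × ℝ → ℝ) (m : ℝ) (x : ℝ) : ℝ := ∫ s in (0:ℝ)..x, Q s * gL φ m s

lemma int_exp_neg {m : ℝ} (hm : 0 < m) : IntegrableOn (fun y : ℝ => exp (-(m * y))) (Ioi 0) := by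
  simpa [neg_mul] using exp_neg_integrableOn_Ioi 0 hm

lemma integral_exp_neg {m : ℝ} (hm : 0 < m) : ∫ y in Ioi (0:ℝ), exp (-(m * y)) = 1 / m := by
  have := integral_exp_mul_Ioi (a := -m) (by linarith) 0
  simp only [neg_mul] at this
  rw [this]; simp

lemma KerData.R0 {Q C M φ R} (h : KerData Q C M φ R) : 0 ≤ R := (abs_nonneg _).trans (h.bd (0,0))

lemma KerData.int_y {Q C M φ R} (h : KerData Q C M φ R) {m : ℝ} (hm : 0 < m) (t : ℝ) :
    IntegrableOn (fun y => φ (t, y) * exp (-(m * y))) (Ioi 0) := by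
  refine Integrable.bdd_mul (c := R) (int_exp_neg hm) ?_ ?_
  · have := h.cont
    exact Continuous.aestronglyMeasurable (by fun_prop)
  · filter_upwards with y using h.bd _

lemma KerData.abs_int_y {Q C M φ R} (h : KerData Q C M φ R) {m : ℝ} (hm : 0 < m) (t : ℝ) :
    |∫ y in Ioi (0:ℝ), φ (t, y) * exp (-(m * y))| ≤ R / m := by
  have : ‖∫ y in Ioi (0:ℝ), φ (t, y) * exp (-(m * y))‖ ≤ ∫ y in Ioi (0:ℝ), R * exp (-(m * y)) := by
    refine norm_integral_le_of_norm_le ((int_exp_neg hm).const_mul R) ?_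
    filter_upwards with y
    rw [norm_mul, Real.norm_eq_abs, Real.norm_eq_abs, abs_of_pos (exp_pos _)]
    exact mul_le_mul_of_nonneg_right (h.bd _) (exp_pos _).le
  rw [integral_const_mul, integral_exp_neg hm] at this
  simpa [div_eq_mul_inv] using this

lemma KerData.gL_cont {Q C M φ R} (h : KerData Q C M φ R) {m : ℝ} (hm : 0 < m) :
    Continuous (gL φ m) := by
  have hc := h.cont
  have : Continuous fun t => ∫ y in Ioi (0:ℝ), φ (t, y) * exp (-(m * y)) := by
    refine continuous_of_dominated (bound := fun y => R * exp (-(m * y))) ?_ ?_ ?_ ?_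
    · intro t; exact (h.int_y hm t).aestronglyMeasurable
    · intro t
      filter_upwards with y
      rw [norm_mul, Real.norm_eq_abs, Real.norm_eq_abs, abs_of_pos (exp_pos _)]
      exact mul_le_mul_of_nonneg_right (h.bd _) (exp_pos _).le
    · exact (int_exp_neg hm).const_mul R
    · filter_upwards with y; fun_prop
  unfold gL
  fun_prop

lemma KerData.gL_bd {Q C M φ R} (h : KerData Q C M φ R) {m : ℝ} (hm : 1 ≤ m) {t : ℝ} (ht : 0 ≤ t) :
    |gL φ m t| ≤ (1 + R) * exp t := by
  have h1 := h.abs_int_y (m := m) (by linarith) t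
  have h2 : R / m ≤ R := div_le_self h.R0 hm
  unfold gL
  have h3 := abs_add_le 1 (exp t * ∫ y in Ioi (0:ℝ), φ (t, y) * exp (-(m * y)))
  rw [abs_mul, abs_of_pos (exp_pos _), abs_one] at h3
  have h4 := mul_le_mul_of_nonneg_left (h1.trans h2) (exp_pos t).le
  have := one_le_exp ht
  linarith

lemma KerData.rho_cont {Q C M φ R} (h : KerData Q C M φ R) {m : ℝ} (hm : 0 < m) :
    Continuous (rhoL Q φ m) :=
  intervalIntegral.continuous_primitive (fun a b => h.ul.int_cont (h.gL_cont hm) a b) 0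

lemma KerData.rho_bd {Q C M φ R} (h : KerData Q C M φ R) {m : ℝ} (hm : 1 ≤ m) {x : ℝ} (hx : 0 ≤ x) :
    |rhoL Q φ m x| ≤ (1 + R) * C * exp x := by
  have h1 : |rhoL Q φ m x| ≤ ∫ s in (0:ℝ)..x, (1 + R) * (exp s * |Q s|) := by
    refine abs_int_le hx ?_ ?_
    · filter_upwards with s hs
      rw [norm_mul, Real.norm_eq_abs, Real.norm_eq_abs]
      have := mul_le_mul_of_nonneg_left (h.gL_bd hm hs.1.le) (abs_nonneg (Q s))
      linarith
    · exact (((h.ul.loc _ _).abs).continuousOn_mul (by fun_prop)).const_mul _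
  rw [intervalIntegral.integral_const_mul] at h1
  have := mul_le_mul_of_nonneg_left (h.ul.bd x hx) (by linarith [h.R0] : 0 ≤ 1 + R)
  linarith

lemma KerData.rho_eq {Q C M φ R} (h : KerData Q C M φ R) {m : ℝ} (hm : 0 < m) {x : ℝ} (hx : 0 ≤ x) :
    ∫ z in Ioi (0:ℝ), exp (-(m * z)) * Nf Q φ x z = rhoL Q φ m x - ∫ s in (0:ℝ)..x, Q s := by
  have hc := h.cont
  have hintg : Integrable (Function.uncurry fun z s => exp (-(m * z)) * (Q s * exp s * φ (s, z)))
      ((volume.restrict (Ioi 0)).prod (volume.restrict (Ioc 0 x))) := by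
    have h1 : Integrable (fun p : ℝ × ℝ => exp (-(m * p.1)) * (Q p.2 * exp p.2))
      ((volume.restrict (Ioi 0)).prod (volume.restrict (Ioc 0 x))) :=
      Integrable.mul_prod (int_exp_neg hm)
        ((intervalIntegrable_iff_integrableOn_Ioc_of_le hx).1 (h.ul.int_exp 0 x))
    have h2 := Integrable.mul_bdd (c := R) (g := fun p : ℝ × ℝ => φ (p.2, p.1)) h1
      (Continuous.aestronglyMeasurable (by fun_prop)) (by filter_upwards with p using h.bd _)
    refine h2.congr ?_
    filter_upwards with p
    simp only [Function.uncurry]; ring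
  have e1 : ∀ z, exp (-(m * z)) * Nf Q φ x z = ∫ s in Ioc 0 x, exp (-(m * z)) * (Q s * exp s * φ (s, z)) := by
    intro z
    rw [Nf, intervalIntegral.integral_of_le hx, integral_const_mul]
  simp_rw [e1]
  rw [integral_integral_swap hintg, rhoL, ← intervalIntegral.integral_sub, intervalIntegral.integral_of_le hx]
  · refine integral_congr_ae ?_
    filter_upwards with s
    simp only [gL]
    have : ∀ z, exp (-(m * z)) * (Q s * exp s * φ (s, z)) = Q s * exp s * (φ (s, z) * exp (-(m * z))) :=
      fun z => by ring
    simp_rw [this]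
    rw [integral_const_mul]; ring
  · exact h.ul.int_cont (h.gL_cont hm) _ _
  · exact h.ul.loc _ _

/-- exponential domination gives integrability on the half line -/
lemma int_of_exp_bd {f : ℝ → ℝ} (hf : AEStronglyMeasurable f (volume.restrict (Ioi 0))) {D a : ℝ} (ha : 0 < a)
    (hb : ∀ t, 0 < t → |f t| ≤ D * exp (-(a * t))) : IntegrableOn f (Ioi 0) := by
  refine Integrable.mono' ((int_exp_neg ha).const_mul D) hf ?_
  filter_upwards [ae_restrict_mem measurableSet_Ioi] with t ht using hb t ht

lemma KerData.g_eq {Q C M φ R} (h : KerData Q C M φ R) {m κ : ℝ} (hm : 1 ≤ m) (hκ : 2 * κ = m + M) {t : ℝ}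
    (ht : 0 ≤ t) : gL φ m t =
      1 - ∫ τ in Ioi (0:ℝ), exp (-(2 * κ * τ)) * (rhoL Q φ m (t + τ) - rhoL Q φ m τ) := by
  have hc := h.cont
  have hm0 : 0 < m := by linarith
  have hM := h.M1
  have hN := Nf_cont h.ul hc h.bd
  have hR0 := h.R0
  have hC := h.ul.C0
  set Φ : ℝ → ℝ → ℝ := fun τ z => exp (-(2 * κ * τ)) * exp (-(m * z)) * (Nf Q φ (t + τ) z - Nf Q φ τ z) with hΦ
  have hΦint : Integrable (Function.uncurry Φ) ((volume.restrict (Ioi 0)).prod (volume.restrict (Ioi 0))) := by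
    have h1 : Integrable (fun p : ℝ × ℝ => (2 * R * C * exp t) * (exp (-((2 * κ - 1) * p.1)) * exp (-(m * p.2))))
      ((volume.restrict (Ioi 0)).prod (volume.restrict (Ioi 0))) :=
      (Integrable.mul_prod (int_exp_neg (by linarith)) (int_exp_neg hm0)).const_mul _
    refine Integrable.mono' h1 ?_ ?_
    · have e1 : Continuous fun p : ℝ × ℝ => Nf Q φ (t + p.1) p.2 :=
        hN.comp (f := fun p : ℝ × ℝ => (t + p.1, p.2)) (by fun_prop)
      have : Continuous (Function.uncurry Φ) := by
        simp only [hΦ, Function.uncurry_def]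
        exact Continuous.mul (by fun_prop) (e1.sub hN)
      exact this.aestronglyMeasurable
    · rw [Measure.prod_restrict]
      filter_upwards [ae_restrict_mem (measurableSet_Ioi.prod measurableSet_Ioi)] with p hp
      have hp1 : 0 < p.1 := hp.1
      simp only [Function.uncurry, hΦ]
      rw [norm_mul, norm_mul, Real.norm_eq_abs, Real.norm_eq_abs, Real.norm_eq_abs, abs_of_pos (exp_pos _),
        abs_of_pos (exp_pos _)]
      have a1 := Nf_bound h.ul h.bd (x := t + p.1) (by linarith) p.2
      have a2 := Nf_bound h.ul h.bd (x := p.1) hp1.le p.2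
      have a3 : R * C * exp p.1 ≤ R * C * exp (t + p.1) :=
        mul_le_mul_of_nonneg_left (exp_le_exp.2 (by linarith)) (mul_nonneg hR0 hC)
      have a4 := abs_sub (Nf Q φ (t + p.1) p.2) (Nf Q φ p.1 p.2)
      calc _ ≤ exp (-(2 * κ * p.1)) * exp (-(m * p.2)) * (2 * R * C * exp (t + p.1)) :=
            mul_le_mul_of_nonneg_left (by linarith) (by positivity)
        _ = _ := by
          have : exp (-((2 * κ - 1) * p.1)) = exp (-(2 * κ * p.1)) * exp p.1 := by rw [← exp_add]; ring_nf
          rw [this, exp_add]; ring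
  obtain ⟨hs1, hs2⟩ := shear hΦint
  have hP := Pf_cont h.ul
  set P : ℝ → ℝ := fun x => ∫ s in (0:ℝ)..x, Q s with hPd
  have hPb : ∀ x, 0 ≤ x → |P x| ≤ C * exp x := fun x hx => Pf_bound h.ul hx
  have hPint : IntegrableOn (fun y => exp (-(2 * κ * y)) * (P (t + y) - P y)) (Ioi 0) := by
    refine int_of_exp_bd (D := 2 * C * exp t) (a := 2 * κ - 1)
      (Continuous.aestronglyMeasurable (by fun_prop)) (by linarith) ?_
    intro y hy
    have a1 := hPb (t + y) (by linarith)
    have a2 := hPb y hy.le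
    have a3 : C * exp y ≤ C * exp (t + y) := mul_le_mul_of_nonneg_left (exp_le_exp.2 (by linarith)) hC
    have a4 := abs_sub (P (t + y)) (P y)
    rw [abs_mul, abs_of_pos (exp_pos _)]
    calc _ ≤ exp (-(2 * κ * y)) * (2 * C * exp (t + y)) := mul_le_mul_of_nonneg_left (by linarith) (exp_pos _).le
      _ = _ := by
          have : exp (-((2 * κ - 1) * y)) = exp (-(2 * κ * y)) * exp y := by rw [← exp_add]; ring_nf
          rw [this, exp_add]; ring
  have e1 : exp t * ∫ y in Ioi (0:ℝ), φ (t, y) * exp (-(m * y)) =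
      ∫ y in Ioi (0:ℝ), (-(exp (-(2 * κ * y)) * (P (t + y) - P y)) - ∫ τ in (0:ℝ)..y, Φ τ (y - τ)) := by
    rw [← integral_const_mul]
    refine setIntegral_congr_fun measurableSet_Ioi fun y hy => ?_
    rw [h.eq t y ht (le_of_lt hy)]
    have e2 : ∫ τ in (0:ℝ)..y, Φ τ (y - τ) = exp (-(m * y)) * Bf Q M φ t y := by
      rw [Bf, ← intervalIntegral.integral_const_mul]
      refine intervalIntegral.integral_congr fun τ _ => ?_
      simp only [hΦ]
      rw [← mul_assoc]
      congr 1
      rw [← exp_add, ← exp_add]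
      congr 1
      rw [hκ]; ring
    rw [e2]
    have e3 : exp (-(2 * κ * y)) = exp (-(m * y)) * exp (-(M * y)) := by
      rw [← exp_add, hκ]; ring_nf
    have e4 : exp t * exp (-t) = 1 := by rw [← exp_add]; simp
    rw [e3]
    calc _ = (exp t * exp (-t)) * ((-(rexp (-(M * y)) * (P (t + y) - P y)) - Bf Q M φ t y) * exp (-(m * y))) := by
          simp only [hPd]; ring
      _ = _ := by rw [e4]; ring
  have hPn : IntegrableOn (fun y => -(exp (-(2 * κ * y)) * (P (t + y) - P y))) (Ioi 0) := hPint.neg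
  rw [gL, e1, integral_sub hPn hs1, integral_neg, hs2]
  have e5 : ∀ τ ∈ Ioi (0:ℝ), ∫ z in Ioi (0:ℝ), Φ τ z =
      exp (-(2 * κ * τ)) * ((rhoL Q φ m (t + τ) - rhoL Q φ m τ) - (P (t + τ) - P τ)) := by
    intro τ hτ
    have hτ' : 0 < τ := hτ
    have i1 : ∀ x, 0 ≤ x → IntegrableOn (fun z => exp (-(m * z)) * Nf Q φ x z) (Ioi 0) := by
      intro x hx
      refine int_of_exp_bd (D := R * C * exp x) (a := m) ?_ hm0 ?_
      · have e1 : Continuous fun p : ℝ => Nf Q φ x p :=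
          hN.comp (f := fun p : ℝ => (x, p)) (by fun_prop)
        exact Continuous.aestronglyMeasurable (by fun_prop)
      · intro z _
        rw [abs_mul, abs_of_pos (exp_pos _), mul_comm]
        exact mul_le_mul_of_nonneg_right (Nf_bound h.ul h.bd hx z) (exp_pos _).le
    have : ∀ z, Φ τ z = exp (-(2 * κ * τ)) * (exp (-(m * z)) * Nf Q φ (t + τ) z - exp (-(m * z)) * Nf Q φ τ z) := by
      intro z; simp only [hΦ]; ring
    simp_rw [this]
    rw [integral_const_mul, integral_sub (i1 _ (by linarith)) (i1 _ hτ'.le), h.rho_eq hm0 (by linarith),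
      h.rho_eq hm0 hτ'.le]
    simp only [hPd]; ring
  rw [setIntegral_congr_fun measurableSet_Ioi e5]
  have hρ := h.rho_cont hm0
  have hρint : IntegrableOn (fun y => exp (-(2 * κ * y)) * (rhoL Q φ m (t + y) - rhoL Q φ m y)) (Ioi 0) := by
    refine int_of_exp_bd (D := 2 * ((1 + R) * C) * exp t) (a := 2 * κ - 1)
      (Continuous.aestronglyMeasurable (by fun_prop)) (by linarith) ?_
    intro y hy
    have a1 := h.rho_bd hm (x := t + y) (by linarith)
    have a2 := h.rho_bd hm hy.le
    have a3 : (1 + R) * C * exp y ≤ (1 + R) * C * exp (t + y) :=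
      mul_le_mul_of_nonneg_left (exp_le_exp.2 (by linarith)) (by positivity)
    have a4 := abs_sub (rhoL Q φ m (t + y)) (rhoL Q φ m y)
    rw [abs_mul, abs_of_pos (exp_pos _)]
    calc _ ≤ exp (-(2 * κ * y)) * (2 * ((1 + R) * C) * exp (t + y)) :=
            mul_le_mul_of_nonneg_left (by linarith) (exp_pos _).le
      _ = _ := by
          have : exp (-((2 * κ - 1) * y)) = exp (-(2 * κ * y)) * exp y := by rw [← exp_add]; ring_nf
          rw [this, exp_add]; ring
  have e6 : ∀ τ, exp (-(2 * κ * τ)) * ((rhoL Q φ m (t + τ) - rhoL Q φ m τ) - (P (t + τ) - P τ)) =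
    exp (-(2 * κ * τ)) * (rhoL Q φ m (t + τ) - rhoL Q φ m τ) - exp (-(2 * κ * τ)) * (P (t + τ) - P τ) := by
    intro τ; ring
  simp_rw [e6]
  rw [integral_sub hρint hPint]
  ring


/-- Solutions of the second order equation with potential κ²+Q on the half line. -/
structure TSol (Q : ℝ → ℝ) (κ : ℝ) (u v : ℝ → ℝ) : Prop where
  d : ∀ t, 0 ≤ t → HasDerivWithinAt u (v t) (Ici 0) t
  cv : ContinuousOn v (Ici 0)
  e : ∀ t, 0 ≤ t → v t = v 0 + ∫ s in (0:ℝ)..t, (κ ^ 2 + Q s) * u s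

lemma TSol.cu {Q κ u v} (h : TSol Q κ u v) : ContinuousOn u (Ici 0) :=
  fun t ht => (h.d t ht).continuousWithinAt

lemma TSol.i {Q κ u v} (h : TSol Q κ u v) {t : ℝ} (ht : 0 ≤ t) : u t = u 0 + ∫ s in (0:ℝ)..t, v s := by
  have hs : uIcc 0 t ⊆ Ici 0 := by rw [uIcc_of_le ht]; exact Icc_subset_Ici_self
  rw [intervalIntegral.integral_eq_sub_of_hasDeriv_right (f := u) (f' := v)]
  · ring
  · exact h.cu.mono hs
  · intro x hx
    rw [min_eq_left ht, max_eq_right ht] at hx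
    exact (h.d x hx.1.le).mono (fun y hy => le_of_lt (lt_trans hx.1 hy))
  · exact (h.cv.mono hs).intervalIntegrable

/-- The product solution: existence. -/
lemma KerData.exists_sol {Q C M φ R} (h : KerData Q C M φ R) {m κ : ℝ} (hm : 1 ≤ m) (hκ : 2 * κ = m + M) :
    ∃ u v : ℝ → ℝ, TSol Q κ u v ∧ u 0 = 1 ∧ (∀ t, 0 ≤ t → u t = exp (-(κ * t)) * gL φ m t) ∧
      ∃ D, 0 ≤ D ∧ ∀ t, 0 ≤ t → |u t| ≤ D * exp (-((κ - 1) * t)) ∧ |v t| ≤ D * exp (-((κ - 1) * t)) := by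
  have hm0 : 0 < m := by linarith
  have hM := h.M1
  have hR0 := h.R0
  have hC := h.ul.C0
  have hρ := h.rho_cont hm0
  have hg := h.gL_cont hm0
  set ρ := rhoL Q φ m with hρd
  have hρ0 : IntegrableOn (fun y => exp (-(2 * κ * y)) * ρ y) (Ioi 0) := by
    refine int_of_exp_bd (D := (1 + R) * C) (a := 2 * κ - 1)
      (Continuous.aestronglyMeasurable (by fun_prop)) (by linarith) ?_
    intro y hy
    have a1 := h.rho_bd hm hy.le
    rw [abs_mul, abs_of_pos (exp_pos _)]
    calc _ ≤ exp (-(2 * κ * y)) * ((1 + R) * C * exp y) :=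
            mul_le_mul_of_nonneg_left (by linarith) (exp_pos _).le
      _ = _ := by
          have : exp (-((2 * κ - 1) * y)) = exp (-(2 * κ * y)) * exp y := by rw [← exp_add]; ring_nf
          rw [this]; ring
  set c := ∫ y in Ioi (0:ℝ), exp (-(2 * κ * y)) * ρ y with hc
  set H : ℝ → ℝ := fun t => ∫ σ in (0:ℝ)..t, exp (-(2 * κ * σ)) * ρ σ with hH
  have hHd : ∀ t, HasDerivAt H (exp (-(2 * κ * t)) * ρ t) t := fun t => by
    have hcont : Continuous fun σ => exp (-(2 * κ * σ)) * ρ σ := by fun_prop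
    exact intervalIntegral.integral_hasDerivAt_right (hcont.intervalIntegrable _ _)
      (hcont.stronglyMeasurableAtFilter _ _) hcont.continuousAt
  set g' : ℝ → ℝ := fun t => 1 + c - exp (2 * κ * t) * (c - H t) with hg'
  have hgg : ∀ t, 0 ≤ t → gL φ m t = g' t := by
    intro t ht
    rw [h.g_eq hm hκ ht]
    have s1 : ∫ σ in Ioi t, exp (-(2 * κ * σ)) * ρ σ = c - H t := by
      have := intervalIntegral.integral_Ioi_sub_Ioi hρ0 ht
      rw [hc, hH]; linarith
    have s2 : ∫ τ in Ioi (0:ℝ), exp (-(2 * κ * (τ + t))) * ρ (τ + t) = c - H t := by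
      rw [← s1]
      have := (measurePreserving_add_right volume t).setIntegral_preimage_emb (measurableEmbedding_addRight t)
        (fun σ => exp (-(2 * κ * σ)) * ρ σ) (Ioi t)
      simpa using this
    have s3 : ∀ τ, exp (-(2 * κ * τ)) * ρ (t + τ) = exp (2 * κ * t) * (exp (-(2 * κ * (τ + t))) * ρ (τ + t)) := by
      intro τ
      rw [← mul_assoc, ← exp_add, add_comm t τ]; ring_nf
    have i1 : IntegrableOn (fun τ => exp (-(2 * κ * τ)) * ρ (t + τ)) (Ioi 0) := by
      simp_rw [s3]
      refine Integrable.const_mul ?_ _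
      have h1 : IntegrableOn (fun σ => exp (-(2 * κ * σ)) * ρ σ) (Ioi t) :=
        hρ0.mono_set (Ioi_subset_Ioi (by linarith))
      have h2 := ((measurePreserving_add_right volume t).integrableOn_comp_preimage
        (measurableEmbedding_addRight t)).2 h1
      simpa [IntegrableOn, Function.comp_def] using h2
    have s4 : ∀ τ, exp (-(2 * κ * τ)) * (ρ (t + τ) - ρ τ) = exp (-(2 * κ * τ)) * ρ (t + τ) - exp (-(2 * κ * τ)) * ρ τ :=
      fun τ => by ring
    rw [← hρd, integral_congr_ae (Filter.Eventually.of_forall s4)]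
    rw [integral_sub i1 hρ0, integral_congr_ae (Filter.Eventually.of_forall s3), integral_const_mul, s2, hg']
    simp only [← hc]
    ring
  have hg'd : ∀ t, HasDerivAt g' (2 * κ * (g' t - 1 - c) + ρ t) t := by
    intro t
    have e1 : HasDerivAt (fun t : ℝ => exp (2 * κ * t)) (exp (2 * κ * t) * (2 * κ * 1)) t :=
      ((hasDerivAt_id t).const_mul (2 * κ)).exp
    have e2 := (e1.mul ((hasDerivAt_const t c).sub (hHd t))).const_sub (1 + c)
    have e3 : -(rexp (2 * κ * t) * (2 * κ * 1) * (c - H t) + rexp (2 * κ * t) * (0 - rexp (-(2 * κ * t)) * ρ t)) =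
        2 * κ * (g' t - 1 - c) + ρ t := by
      have : exp (2 * κ * t) * exp (-(2 * κ * t)) = 1 := by rw [← exp_add]; simp
      simp only [hg']
      linear_combination ρ t * this
    rw [← e3]
    exact e2
  have hg'c : Continuous g' := continuous_iff_continuousAt.2 fun t => (hg'd t).continuousAt
  set B : ℝ → ℝ := fun t => κ * g' t - 2 * κ * (1 + c) + ρ t with hB
  have hBc : Continuous B := by fun_prop
  refine ⟨fun t => exp (-(κ * t)) * g' t, fun t => exp (-(κ * t)) * B t, ⟨?_, ?_, ?_⟩, ?_, ?_, ?_⟩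
  · intro t ht
    have e1 : HasDerivAt (fun t : ℝ => exp (-(κ * t))) (exp (-(κ * t)) * (-(κ * 1))) t :=
      (((hasDerivAt_id t).const_mul κ).neg).exp
    have e2 := e1.mul (hg'd t)
    have e3 : rexp (-(κ * t)) * -(κ * 1) * g' t + rexp (-(κ * t)) * (2 * κ * (g' t - 1 - c) + ρ t) =
      exp (-(κ * t)) * B t := by simp only [hB]; ring
    rw [e3] at e2
    exact e2.hasDerivWithinAt
  · exact Continuous.continuousOn (by fun_prop)
  · intro t ht
    have := ac_prod_rule ht (A := fun t => exp (-(κ * t))) (B := B) (α := fun t => -κ * exp (-(κ * t)))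
      (β := fun t => κ * (2 * κ * (g' t - 1 - c) + ρ t) + Q t * gL φ m t)
      (Continuous.intervalIntegrable (by fun_prop) _ _)
      ((Continuous.intervalIntegrable (by fun_prop) _ _).add (h.ul.int_cont hg _ _)) ?_ ?_
    · rw [eq_add_of_sub_eq this]
      simp only [mul_zero, neg_zero, exp_zero, one_mul]
      rw [add_comm]
      congr 1
      refine intervalIntegral.integral_congr fun s hs => ?_
      rw [uIcc_of_le ht] at hs
      simp only [hgg s hs.1, hB]
      ring
    · intro x hx
      have hd : ∀ y ∈ uIcc (0:ℝ) x, HasDerivAt (fun t : ℝ => exp (-(κ * t))) (-κ * exp (-(κ * y))) y := by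
        intro y _
        have e1 : HasDerivAt (fun t : ℝ => exp (-(κ * t))) (exp (-(κ * y)) * (-(κ * 1))) y :=
          (((hasDerivAt_id y).const_mul κ).neg).exp
        rw [show -κ * exp (-(κ * y)) = exp (-(κ * y)) * (-(κ * 1)) by ring]
        exact e1
      rw [intervalIntegral.integral_eq_sub_of_hasDerivAt hd (Continuous.intervalIntegrable (by fun_prop) _ _)]
      ring
    · intro x hx
      have i1 : ∫ s in (0:ℝ)..x, (2 * κ * (g' s - 1 - c) + ρ s) = g' x - g' 0 :=
        intervalIntegral.integral_eq_sub_of_hasDerivAt (fun y _ => hg'd y)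
          (Continuous.intervalIntegrable (by fun_prop) _ _)
      rw [intervalIntegral.integral_add (Continuous.intervalIntegrable (by fun_prop) _ _) (h.ul.int_cont hg _ _),
        intervalIntegral.integral_const_mul, i1]
      simp only [hB, hρd, rhoL, intervalIntegral.integral_same]
      ring
  · simp [hg', hH]
  · intro t ht
    simp only [hgg t ht]
  · refine ⟨(|κ| + 1) * (1 + R) + |2 * κ * (1 + c)| + (1 + R) * C, by positivity, fun t ht => ?_⟩
    have b1 := h.gL_bd hm ht
    have b2 := h.rho_bd hm ht
    rw [hgg t ht] at b1
    have b3 := one_le_exp ht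
    have e1 : exp (-((κ - 1) * t)) = exp (-(κ * t)) * exp t := by rw [← exp_add]; ring_nf
    have e2 : ∀ x : ℝ, |exp (-(κ * t)) * x| = exp (-(κ * t)) * |x| := fun x => by
      rw [abs_mul, abs_of_pos (exp_pos _)]
    simp only [e1, e2]
    have p1 : 0 ≤ |κ| * (1 + R) * exp t := by positivity
    have p2 : 0 ≤ |2 * κ * (1 + c)| * exp t := by positivity
    have p3 : 0 ≤ (1 + R) * C * exp t := by positivity
    have p4 : 0 ≤ (1 + R) * exp t := by positivity
    have p5 : |2 * κ * (1 + c)| ≤ |2 * κ * (1 + c)| * exp t := le_mul_of_one_le_right (abs_nonneg _) b3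
    constructor
    · rw [mul_left_comm]
      refine mul_le_mul_of_nonneg_left ?_ (exp_pos _).le
      linarith
    · rw [mul_left_comm]
      refine mul_le_mul_of_nonneg_left ?_ (exp_pos _).le
      have q1 : |B t| ≤ |κ * g' t| + |2 * κ * (1 + c)| + |ρ t| := by
        simp only [hB]
        exact (abs_add_le _ _).trans (by gcongr; exact abs_sub _ _)
      have q2 : |κ * g' t| ≤ |κ| * ((1 + R) * exp t) := by
        rw [abs_mul]; exact mul_le_mul_of_nonneg_left b1 (abs_nonneg _)
      linarith


lemma TSol.contIcc {f : ℝ → ℝ} (h : ContinuousOn f (Ici 0)) (L : ℝ) (hL : 0 ≤ L) : ContinuousOn f (uIcc 0 L) :=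
  h.mono (by rw [uIcc_of_le hL]; exact Icc_subset_Ici_self)

lemma wronskian {Q₁ Q₂ : ℝ → ℝ} {κ : ℝ} {u₁ v₁ u₂ v₂ : ℝ → ℝ}
    (hQ₁ : ∀ a b, IntervalIntegrable Q₁ volume a b) (hQ₂ : ∀ a b, IntervalIntegrable Q₂ volume a b)
    (h₁ : TSol Q₁ κ u₁ v₁) (h₂ : TSol Q₂ κ u₂ v₂) {L : ℝ} (hL : 0 ≤ L) :
    (v₁ L * u₂ L - u₁ L * v₂ L) - (v₁ 0 * u₂ 0 - u₁ 0 * v₂ 0) =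
      ∫ s in (0:ℝ)..L, (Q₁ s - Q₂ s) * (u₁ s * u₂ s) := by
  have cu₁ := TSol.contIcc h₁.cu L hL
  have cu₂ := TSol.contIcc h₂.cu L hL
  have cv₁ := TSol.contIcc h₁.cv L hL
  have cv₂ := TSol.contIcc h₂.cv L hL
  have i₁ : IntervalIntegrable (fun s => (κ ^ 2 + Q₁ s) * u₁ s) volume 0 L :=
    ((intervalIntegrable_const).add (hQ₁ 0 L)).mul_continuousOn cu₁
  have i₂ : IntervalIntegrable (fun s => (κ ^ 2 + Q₂ s) * u₂ s) volume 0 L :=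
    ((intervalIntegrable_const).add (hQ₂ 0 L)).mul_continuousOn cu₂
  have e₁ := ac_prod_rule hL i₁ cv₂.intervalIntegrable (A := v₁) (B := u₂)
    (fun t ht => h₁.e t ht.1) (fun t ht => h₂.i ht.1)
  have e₂ := ac_prod_rule hL cv₁.intervalIntegrable i₂ (A := u₁) (B := v₂)
    (fun t ht => h₁.i ht.1) (fun t ht => h₂.e t ht.1)
  have : (v₁ L * u₂ L - u₁ L * v₂ L) - (v₁ 0 * u₂ 0 - u₁ 0 * v₂ 0) =
    (v₁ L * u₂ L - v₁ 0 * u₂ 0) - (u₁ L * v₂ L - u₁ 0 * v₂ 0) := by ring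
  rw [this, e₁, e₂, ← intervalIntegral.integral_sub]
  · refine intervalIntegral.integral_congr fun s _ => ?_
    ring
  · exact (i₁.mul_continuousOn cu₂).add ((cv₁.mul cv₂).intervalIntegrable)
  · exact ((cv₁.mul cv₂).intervalIntegrable).add (i₂.continuousOn_mul cu₁)

lemma TSol.sub {Q : ℝ → ℝ} {κ : ℝ} {u₁ v₁ u₂ v₂ : ℝ → ℝ} (hQ : ∀ a b, IntervalIntegrable Q volume a b)
    (h₁ : TSol Q κ u₁ v₁) (h₂ : TSol Q κ u₂ v₂) :
    TSol Q κ (fun t => u₁ t - u₂ t) (fun t => v₁ t - v₂ t) := by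
  refine ⟨fun t ht => (h₁.d t ht).sub (h₂.d t ht), h₁.cv.sub h₂.cv, fun t ht => ?_⟩
  have cu₁ := TSol.contIcc h₁.cu t ht
  have cu₂ := TSol.contIcc h₂.cu t ht
  have i₁ : IntervalIntegrable (fun s => (κ ^ 2 + Q s) * u₁ s) volume 0 t :=
    ((intervalIntegrable_const).add (hQ 0 t)).mul_continuousOn cu₁
  have i₂ : IntervalIntegrable (fun s => (κ ^ 2 + Q s) * u₂ s) volume 0 t :=
    ((intervalIntegrable_const).add (hQ 0 t)).mul_continuousOn cu₂
  simp_rw [mul_sub]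
  rw [intervalIntegral.integral_sub i₁ i₂, h₁.e t ht, h₂.e t ht]
  ring

lemma TSol.zero_of_init {Q : ℝ → ℝ} {κ : ℝ} {w z : ℝ → ℝ} (hQ : ∀ a b, IntervalIntegrable Q volume a b)
    (h : TSol Q κ w z) (hw : w 0 = 0) (hz : z 0 = 0) : ∀ t, 0 ≤ t → w t = 0 := by
  intro L hL
  have cw := TSol.contIcc h.cu L hL
  have cz := TSol.contIcc h.cv L hL
  rw [uIcc_of_le hL] at cw cz
  have hk : IntervalIntegrable (fun s => 1 + κ ^ 2 + |Q s|) volume 0 L :=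
    intervalIntegrable_const.add (hQ 0 L).abs
  have key := gronwall_zero hL (φ := fun t => |w t| + |z t|) (k := fun s => 1 + κ ^ 2 + |Q s|)
    (cw.abs.add cz.abs) (fun t _ => by positivity) hk (fun t _ => by positivity) ?_ L ⟨hL, le_rfl⟩
  · have := abs_nonneg (w L)
    have := abs_nonneg (z L)
    exact abs_eq_zero.1 (by linarith)
  · intro t ht
    have cw' := cw.mono (Icc_subset_Icc_right ht.2)
    have cz' := cz.mono (Icc_subset_Icc_right ht.2)
    rw [← uIcc_of_le ht.1] at cw' cz'
    have j1 : IntervalIntegrable (fun s => |z s|) volume 0 t := cz'.abs.intervalIntegrable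
    have j2 : IntervalIntegrable (fun s => (κ ^ 2 + |Q s|) * |w s|) volume 0 t :=
      (intervalIntegrable_const.add (hQ 0 t).abs).mul_continuousOn cw'.abs
    have a1 : |w t| ≤ ∫ s in (0:ℝ)..t, |z s| := by
      rw [h.i ht.1, hw, zero_add]
      exact abs_int_le ht.1 (by filter_upwards with s _ using le_rfl) j1
    have a2 : |z t| ≤ ∫ s in (0:ℝ)..t, (κ ^ 2 + |Q s|) * |w s| := by
      rw [h.e t ht.1, hz, zero_add]
      refine abs_int_le ht.1 ?_ j2
      filter_upwards with s _
      rw [norm_mul, Real.norm_eq_abs, Real.norm_eq_abs]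
      refine mul_le_mul_of_nonneg_right ?_ (abs_nonneg _)
      refine (abs_add_le _ _).trans (by rw [abs_of_nonneg (sq_nonneg κ)])
    refine (add_le_add a1 a2).trans ?_
    rw [← intervalIntegral.integral_add j1 j2]
    refine intervalIntegral.integral_mono_on ht.1 (j1.add j2) ?_ ?_
    · exact (intervalIntegrable_const.add (hQ 0 t).abs).mul_continuousOn (cw'.abs.add cz'.abs)
    · intro s _
      have q1 := abs_nonneg (w s)
      have q2 := abs_nonneg (z s)
      have q3 := abs_nonneg (Q s)
      nlinarith [mul_nonneg q3 q2, mul_nonneg (sq_nonneg κ) q2]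

lemma TSol.uniq_zero {Q : ℝ → ℝ} {κ : ℝ} {u v w z : ℝ → ℝ} (hQ : ∀ a b, IntervalIntegrable Q volume a b)
    (hκ : 2 ≤ κ) (hu : TSol Q κ u v) (hu0 : u 0 = 1) {D : ℝ}
    (hD : ∀ t, 0 ≤ t → |u t| ≤ D * exp (-((κ - 1) * t)) ∧ |v t| ≤ D * exp (-((κ - 1) * t)))
    (hw : TSol Q κ w z) (hw0 : w 0 = 0) (hw2 : IntegrableOn (fun t => w t ^ 2 * exp (-t)) (Ioi 0)) :
    ∀ t, 0 ≤ t → w t = 0 := by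
  refine hw.zero_of_init hQ hw0 ?_
  set c := z 0 with hc
  have hwr : ∀ t, 0 ≤ t → z t * u t - w t * v t = c := by
    intro t ht
    have := wronskian hQ hQ hw hu ht
    simp only [sub_self, zero_mul, intervalIntegral.integral_zero, hw0, hu0] at this
    linarith
  have hD0 : 0 ≤ D := by
    have := (hD 0 le_rfl).1
    simp at this
    exact (abs_nonneg _).trans this
  set f : ℝ → ℝ := fun t => w t ^ 2 * exp (-t) + exp (-t) with hf
  have hfi : IntegrableOn f (Ioi 0) := hw2.add (by simpa using int_exp_neg one_pos)
  have hbound : ∀ n : ℕ, |c| ≤ (9 * D) * ∫ t in (n:ℝ)..(n+1), f t := by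
    intro n
    have hn0 : (0:ℝ) ≤ n := Nat.cast_nonneg n
    have hsub : uIcc (n:ℝ) (n+1) ⊆ Ici 0 := by
      rw [uIcc_of_le (by linarith)]; intro x hx; exact hn0.trans hx.1
    have cu := hu.cu.mono hsub
    have cv := hu.cv.mono hsub
    have cw := hw.cu.mono hsub
    have cz := hw.cv.mono hsub
    set η : ℝ → ℝ := fun t => 6 * (t - n) * (n + 1 - t) with hη
    set η' : ℝ → ℝ := fun t => 6 * (n + 1 - t) - 6 * (t - n) with hη'
    have hηd : ∀ t, HasDerivAt η (η' t) t := by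
      intro t
      have := (((hasDerivAt_id t).sub_const (n:ℝ)).const_mul 6).mul ((hasDerivAt_id t).const_sub ((n:ℝ) + 1))
      exact this.congr_deriv (by simp only [hη', id]; ring)
    have hηc : Continuous η := by fun_prop
    have hη'c : Continuous η' := by fun_prop
    have I0 : ∫ t in (n:ℝ)..(n+1), (η' t * (u t * w t) + η t * (v t * w t + u t * z t)) = 0 := by
      rw [intervalIntegral.integral_eq_sub_of_hasDeriv_right (f := fun t => η t * (u t * w t))]
      · simp [hη]
      · exact hηc.continuousOn.mul (cu.mul cw)
      · intro x hx
        rw [min_eq_left (by linarith), max_eq_right (by linarith)] at hx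
        have hx0 : 0 ≤ x := hn0.trans hx.1.le
        have hs : Ioi x ⊆ Ici 0 := fun y hy => hx0.trans (le_of_lt hy)
        exact (hηd x).hasDerivWithinAt.mul (((hu.d x hx0).mono hs).mul ((hw.d x hx0).mono hs))
      · refine ContinuousOn.intervalIntegrable ?_
        exact (hη'c.continuousOn.mul (cu.mul cw)).add (hηc.continuousOn.mul ((cv.mul cw).add (cu.mul cz)))
    have I1 : ∫ t in (n:ℝ)..(n+1), η t = 1 := by
      have hd : ∀ t ∈ uIcc (n:ℝ) (n+1), HasDerivAt (fun t : ℝ => 3 * (t - n) ^ 2 - 2 * (t - n) ^ 3) (η t) t := by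
        intro t _
        have h1 := (((hasDerivAt_id t).sub_const (n:ℝ)).pow 2).const_mul 3
        have h2 := (((hasDerivAt_id t).sub_const (n:ℝ)).pow 3).const_mul 2
        exact (h1.sub h2).congr_deriv (by simp only [hη, id]; push_cast; ring)
      rw [intervalIntegral.integral_eq_sub_of_hasDerivAt hd (hηc.intervalIntegrable _ _)]
      ring
    have I2 : c = - ∫ t in (n:ℝ)..(n+1), w t * (η' t * u t + 2 * (η t * v t)) := by
      have cj : IntervalIntegrable (fun t => w t * (η' t * u t + 2 * (η t * v t))) volume (n:ℝ) (n+1) := by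
        refine ContinuousOn.intervalIntegrable ?_
        exact cw.mul ((hη'c.continuousOn.mul cu).add (continuousOn_const.mul (hηc.continuousOn.mul cv)))
      have e1 : ∫ t in (n:ℝ)..(n+1), (w t * (η' t * u t + 2 * (η t * v t)) + c * η t) = 0 := by
        rw [← I0]
        refine intervalIntegral.integral_congr fun t ht => ?_
        have := hwr t (hsub ht)
        simp only [← this]; ring
      rw [intervalIntegral.integral_add cj ((hηc.intervalIntegrable _ _).const_mul c),
        intervalIntegral.integral_const_mul, I1] at e1
      linarith
    rw [I2, abs_neg, ← intervalIntegral.integral_const_mul]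
    refine abs_int_le (by linarith) ?_ ?_
    · filter_upwards with t ht
      have ht0 : 0 ≤ t := hn0.trans ht.1.le
      have ha : 0 ≤ t - n := by linarith [ht.1]
      have hb : 0 ≤ n + 1 - t := by linarith [ht.2]
      have b1 : |η' t| ≤ 6 := by
        simp only [hη']; rw [abs_le]; constructor <;> linarith
      have b2 : |η t| ≤ 6 := by
        simp only [hη]
        rw [abs_of_nonneg (by positivity)]
        nlinarith
      have b2' : |η t| ≤ 3 / 2 := by
        simp only [hη]
        rw [abs_of_nonneg (by positivity)]
        nlinarith [sq_nonneg (2 * (t - n) - 1)]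
      obtain ⟨d1, d2⟩ := hD t ht0
      set E := exp (-((κ - 1) * t)) with hE
      have hE0 : 0 < E := exp_pos _
      have b3 : |η' t * u t + 2 * (η t * v t)| ≤ 9 * (D * E) := by
        refine (abs_add_le _ _).trans ?_
        rw [abs_mul, abs_mul, abs_mul, abs_of_pos (by norm_num : (0:ℝ) < 2)]
        have c1 := mul_le_mul b1 d1 (abs_nonneg _) (by norm_num)
        have c2 := mul_le_mul b2' d2 (abs_nonneg _) (by norm_num)
        linarith
      have b4 : |w t| * E ≤ f t := by
        have hE' : E ≤ exp (-t) := exp_le_exp.2 (by nlinarith)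
        have b5 : |w t| ≤ w t ^ 2 + 1 := by
          nlinarith [sq_abs (w t), sq_nonneg (|w t| - 1), abs_nonneg (w t)]
        calc |w t| * E ≤ (w t ^ 2 + 1) * exp (-t) := mul_le_mul b5 hE' hE0.le (by positivity)
          _ = f t := by simp only [hf]; ring
      rw [norm_mul, Real.norm_eq_abs, Real.norm_eq_abs]
      calc |w t| * |η' t * u t + 2 * (η t * v t)| ≤ |w t| * (9 * (D * E)) :=
            mul_le_mul_of_nonneg_left b3 (abs_nonneg _)
        _ = 9 * D * (|w t| * E) := by ring
        _ ≤ 9 * D * f t := mul_le_mul_of_nonneg_left b4 (by positivity)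
    · refine ContinuousOn.intervalIntegrable ?_
      refine continuousOn_const.mul ?_
      have : ContinuousOn (fun t : ℝ => exp (-t)) (uIcc (n:ℝ) (n+1)) := Continuous.continuousOn (by fun_prop)
      exact ((cw.pow 2).mul this).add this
  have hlim : Filter.Tendsto (fun n : ℕ => (9 * D) * ∫ t in (n:ℝ)..(n+1), f t) Filter.atTop (nhds 0) := by
    have l1 : Filter.Tendsto (fun n : ℕ => ∫ t in (0:ℝ)..(n:ℝ), f t) Filter.atTop (nhds (∫ t in Ioi (0:ℝ), f t)) :=
      intervalIntegral_tendsto_integral_Ioi 0 hfi tendsto_natCast_atTop_atTop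
    have l2 : Filter.Tendsto (fun n : ℕ => ∫ t in (0:ℝ)..((n:ℝ)+1), f t) Filter.atTop (nhds (∫ t in Ioi (0:ℝ), f t)) :=
      intervalIntegral_tendsto_integral_Ioi 0 hfi
        (Filter.tendsto_atTop_add_const_right _ _ tendsto_natCast_atTop_atTop)
    have l3 := (l2.sub l1).const_mul (9 * D)
    rw [sub_self, mul_zero] at l3
    refine l3.congr fun n => ?_
    have hii : ∀ a b : ℝ, 0 ≤ a → 0 ≤ b → IntervalIntegrable f volume a b := by
      intro a b ha hb
      refine (intervalIntegrable_iff).2 (hfi.mono_set ?_)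
      intro x hx
      exact (le_min ha hb).trans_lt hx.1
    rw [← intervalIntegral.integral_add_adjacent_intervals (b := (n:ℝ)) (hii 0 n le_rfl (by positivity))
      (hii n (n+1) (by positivity) (by positivity))]
    ring
  have := ge_of_tendsto' hlim hbound
  exact abs_eq_zero.1 (le_antisymm this (abs_nonneg _))


lemma ULQ.mono {Q : ℝ → ℝ} {C C' : ℝ} (h : ULQ Q C) (hC : C ≤ C') : ULQ Q C' :=
  ⟨h.meas, h.loc, h.C0.trans hC, fun x hx => (h.bd x hx).trans (mul_le_mul_of_nonneg_right hC (exp_pos _).le)⟩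

lemma ULQ.int2 {Q : ℝ → ℝ} {C : ℝ} (h : ULQ Q C) : IntegrableOn (fun t => Q t * exp (-(2 * t))) (Ioi 0) := by
  have hC := h.C0
  set F : ℝ → ℝ := fun x => ∫ s in (0:ℝ)..x, exp s * |Q s| with hF
  have hFi : ∀ a b : ℝ, IntervalIntegrable (fun s => exp s * |Q s|) volume a b := fun a b =>
    ((h.loc a b).abs).continuousOn_mul (by fun_prop)
  have hFc : Continuous F := intervalIntegral.continuous_primitive hFi 0
  have hbd : ∀ x : ℝ, 0 ≤ x → ∫ t in (0:ℝ)..x, ‖Q t * exp (-(2 * t))‖ ≤ C + 3 * C := by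
    intro x hx
    have := ac_prod_rule hx (A := fun t => exp (-(3 * t))) (B := F) (α := fun t => -3 * exp (-(3 * t)))
      (β := fun s => exp s * |Q s|) (Continuous.intervalIntegrable (by fun_prop) _ _) (hFi _ _) ?_ ?_
    · have e0 : F 0 = 0 := by simp [hF]
      rw [e0, mul_zero, sub_zero, intervalIntegral.integral_add (Continuous.intervalIntegrable (by fun_prop) _ _)
        ((hFi _ _).continuousOn_mul (by fun_prop))] at this
      have e1 : ∫ t in (0:ℝ)..x, ‖Q t * exp (-(2 * t))‖ = ∫ t in (0:ℝ)..x, exp (-(3 * t)) * (exp t * |Q t|) := by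
        refine intervalIntegral.integral_congr fun t _ => ?_
        rw [norm_mul, Real.norm_eq_abs, Real.norm_eq_abs, abs_of_pos (exp_pos _), ← mul_assoc, ← exp_add, mul_comm]
        ring_nf
      have e2 : exp (-(3 * x)) * F x ≤ C := by
        calc exp (-(3 * x)) * F x ≤ exp (-(3 * x)) * (C * exp x) :=
              mul_le_mul_of_nonneg_left (h.bd x hx) (exp_pos _).le
          _ = C * exp (-(2 * x)) := by rw [mul_left_comm, ← exp_add]; ring_nf
          _ ≤ C * 1 := mul_le_mul_of_nonneg_left (exp_le_one_iff.2 (by linarith)) hC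
          _ = C := mul_one _
      have e3 : - ∫ t in (0:ℝ)..x, -3 * exp (-(3 * t)) * F t ≤ 3 * C := by
        rw [← intervalIntegral.integral_neg]
        calc _ ≤ ∫ t in (0:ℝ)..x, 3 * C * exp (-(1 * t)) := by
              refine intervalIntegral.integral_mono_on hx (Continuous.intervalIntegrable (by fun_prop) _ _)
                (Continuous.intervalIntegrable (by fun_prop) _ _) fun t ht => ?_
              calc -(-3 * exp (-(3 * t)) * F t) = 3 * (exp (-(3 * t)) * F t) := by ring
                _ ≤ 3 * (exp (-(3 * t)) * (C * exp t)) := by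
                    have := mul_le_mul_of_nonneg_left (h.bd t ht.1) (exp_pos (-(3 * t))).le
                    linarith
                _ = 3 * C * exp (-(2 * t)) := by
                    have : exp (-(2 * t)) = exp (-(3 * t)) * exp t := by rw [← exp_add]; ring_nf
                    rw [this]; ring
                _ ≤ _ := mul_le_mul_of_nonneg_left (exp_le_exp.2 (by linarith [ht.1])) (by linarith)
          _ ≤ 3 * C := by
            rw [intervalIntegral.integral_const_mul, intervalIntegral.integral_of_le hx]
            have : ∫ t in Ioc 0 x, exp (-(1 * t)) ≤ ∫ t in Ioi (0:ℝ), exp (-(1 * t)) :=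
              setIntegral_mono_set (int_exp_neg one_pos) (by filter_upwards with t using (exp_pos _).le)
                (Ioc_subset_Ioi_self.eventuallyLE)
            rw [integral_exp_neg one_pos] at this
            nlinarith
      rw [e1]; linarith
    · intro y hy
      have hd : ∀ z ∈ uIcc (0:ℝ) y, HasDerivAt (fun t : ℝ => exp (-(3 * t))) (-3 * exp (-(3 * z))) z := by
        intro z _
        have e1 : HasDerivAt (fun t : ℝ => exp (-(3 * t))) (exp (-(3 * z)) * (-(3 * 1))) z :=
          (((hasDerivAt_id z).const_mul 3).neg).exp
        exact e1.congr_deriv (by ring)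
      rw [intervalIntegral.integral_eq_sub_of_hasDerivAt hd (Continuous.intervalIntegrable (by fun_prop) _ _)]
      ring
    · intro y hy; simp [hF]
  refine integrableOn_Ioi_of_intervalIntegral_norm_bounded (C + 3 * C) 0 (b := fun x : ℝ => x) (l := Filter.atTop)
    ?_ Filter.tendsto_id ?_
  · intro x
    by_cases hx : 0 ≤ x
    · exact (intervalIntegrable_iff_integrableOn_Ioc_of_le hx).1 (h.int_cont (by fun_prop) 0 x)
    · rw [Ioc_eq_empty (by intro h; exact hx h.le)]; exact integrableOn_empty
  · filter_upwards [Filter.eventually_ge_atTop 0] with x hx using hbd x hx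

/-- product kernel -/
def Kp (M : ℝ) (φ₁ φ₂ : ℝ × ℝ → ℝ) (p : ℝ × ℝ) : ℝ :=
  exp (M * p.2) * (exp p.1 * (φ₁ p + φ₂ p) + exp (2 * p.1) * ∫ τ in (0:ℝ)..p.2, φ₁ (p.1, τ) * φ₂ (p.1, p.2 - τ))

lemma Kp_cont (M : ℝ) {φ₁ φ₂ : ℝ × ℝ → ℝ} (h₁ : Continuous φ₁) (h₂ : Continuous φ₂) : Continuous (Kp M φ₁ φ₂) := by
  have : Continuous fun p : ℝ × ℝ => ∫ τ in (0:ℝ)..p.2, φ₁ (p.1, τ) * φ₂ (p.1, p.2 - τ) := by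
    apply intervalIntegral.continuous_parametric_intervalIntegral_of_continuous
      (f := fun (p : ℝ × ℝ) τ => φ₁ (p.1, τ) * φ₂ (p.1, p.2 - τ))
    · simp only [Function.uncurry_def]; fun_prop
    · fun_prop
  unfold Kp
  fun_prop

lemma Kp_bd (M : ℝ) {φ₁ φ₂ : ℝ × ℝ → ℝ} {R₁ R₂ : ℝ}
    (b₁ : ∀ p, |φ₁ p| ≤ R₁) (b₂ : ∀ p, |φ₂ p| ≤ R₂) {t z : ℝ} (ht : 0 ≤ t) (hz : 0 ≤ z) :
    |Kp M φ₁ φ₂ (t, z)| ≤ (R₁ + R₂ + R₁ * R₂) * exp (2 * t) * exp ((M + 1) * z) := by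
  have r1 : 0 ≤ R₁ := (abs_nonneg _).trans (b₁ (0,0))
  have r2 : 0 ≤ R₂ := (abs_nonneg _).trans (b₂ (0,0))
  have a1 : |∫ τ in (0:ℝ)..z, φ₁ (t, τ) * φ₂ (t, z - τ)| ≤ R₁ * R₂ * z := by
    have := intervalIntegral.norm_integral_le_of_norm_le_const (a := 0) (b := z) (C := R₁ * R₂)
      (f := fun τ => φ₁ (t, τ) * φ₂ (t, z - τ)) (fun τ _ => by
        rw [norm_mul]; exact mul_le_mul (b₁ _) (b₂ _) (norm_nonneg _) r1)
    rw [sub_zero, abs_of_nonneg hz] at this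
    exact this
  have a2 : z ≤ exp z := by linarith [add_one_le_exp z]
  have a3 : 1 ≤ exp z := one_le_exp hz
  have a4 : exp t ≤ exp (2 * t) := exp_le_exp.2 (by linarith)
  unfold Kp
  simp only
  rw [abs_mul, abs_of_pos (exp_pos _)]
  have e1 : exp ((M + 1) * z) = exp (M * z) * exp z := by rw [← exp_add]; ring_nf
  rw [e1]
  have : |exp t * (φ₁ (t, z) + φ₂ (t, z)) + exp (2 * t) * ∫ τ in (0:ℝ)..z, φ₁ (t, τ) * φ₂ (t, z - τ)| ≤
      (R₁ + R₂ + R₁ * R₂) * exp (2 * t) * exp z := by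
    refine (abs_add_le _ _).trans ?_
    rw [abs_mul, abs_mul, abs_of_pos (exp_pos _), abs_of_pos (exp_pos _)]
    have c1 : |φ₁ (t, z) + φ₂ (t, z)| ≤ R₁ + R₂ := (abs_add_le _ _).trans (add_le_add (b₁ _) (b₂ _))
    have c2 : exp t * |φ₁ (t, z) + φ₂ (t, z)| ≤ exp (2 * t) * ((R₁ + R₂) * exp z) :=
      mul_le_mul a4 (c1.trans (le_mul_of_one_le_right (by positivity) a3)) (abs_nonneg _) (exp_pos _).le
    have c3 : exp (2 * t) * |∫ τ in (0:ℝ)..z, φ₁ (t, τ) * φ₂ (t, z - τ)| ≤ exp (2 * t) * (R₁ * R₂ * exp z) :=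
      mul_le_mul_of_nonneg_left (a1.trans (mul_le_mul_of_nonneg_left a2 (by positivity))) (exp_pos _).le
    linarith
  calc _ ≤ exp (M * z) * ((R₁ + R₂ + R₁ * R₂) * exp (2 * t) * exp z) := mul_le_mul_of_nonneg_left this (exp_pos _).le
    _ = _ := by ring

/-- g₁ g₂ as a Laplace transform. -/
lemma gg_eq {Q₁ Q₂ : ℝ → ℝ} {C M : ℝ} {φ₁ φ₂ : ℝ × ℝ → ℝ} {R₁ R₂ : ℝ} (h₁ : KerData Q₁ C M φ₁ R₁)
    (h₂ : KerData Q₂ C M φ₂ R₂) {m κ : ℝ} (hm : 2 ≤ m) (hκ : 2 * κ = m + M) (t : ℝ) :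
    gL φ₁ m t * gL φ₂ m t = 1 + ∫ z in Ioi (0:ℝ), Kp M φ₁ φ₂ (t, z) * exp (-(2 * κ * z)) := by
  have hm0 : 0 < m := by linarith
  have i1 := h₁.int_y hm0 t
  have i2 := h₂.int_y hm0 t
  have c1 := h₁.cont
  have c2 := h₂.cont
  have hintg : Integrable (Function.uncurry fun τ z => (φ₁ (t, τ) * exp (-(m * τ))) * (φ₂ (t, z) * exp (-(m * z))))
      ((volume.restrict (Ioi 0)).prod (volume.restrict (Ioi 0))) := Integrable.mul_prod i1 i2
  obtain ⟨s1, s2⟩ := shear hintg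
  set I₁ := ∫ y in Ioi (0:ℝ), φ₁ (t, y) * exp (-(m * y)) with hI₁
  set I₂ := ∫ y in Ioi (0:ℝ), φ₂ (t, y) * exp (-(m * y)) with hI₂
  have s3 : ∫ τ in Ioi (0:ℝ), ∫ z in Ioi (0:ℝ), (φ₁ (t, τ) * exp (-(m * τ))) * (φ₂ (t, z) * exp (-(m * z))) = I₁ * I₂ := by
    simp_rw [integral_const_mul]
    rw [integral_mul_const]
  rw [s3] at s2
  have e : ∀ z, Kp M φ₁ φ₂ (t, z) * exp (-(2 * κ * z)) =
      (exp t * (φ₁ (t, z) * exp (-(m * z))) + exp t * (φ₂ (t, z) * exp (-(m * z)))) +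
      exp (2 * t) * ∫ τ in (0:ℝ)..z, (φ₁ (t, τ) * exp (-(m * τ))) * (φ₂ (t, z - τ) * exp (-(m * (z - τ)))) := by
    intro z
    have e1 : ∫ τ in (0:ℝ)..z, (φ₁ (t, τ) * exp (-(m * τ))) * (φ₂ (t, z - τ) * exp (-(m * (z - τ)))) =
        exp (-(m * z)) * ∫ τ in (0:ℝ)..z, φ₁ (t, τ) * φ₂ (t, z - τ) := by
      rw [← intervalIntegral.integral_const_mul]
      refine intervalIntegral.integral_congr fun τ _ => ?_
      have : exp (-(m * z)) = exp (-(m * τ)) * exp (-(m * (z - τ))) := by rw [← exp_add]; ring_nf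
      simp only [this]; ring
    rw [e1]
    have e2 : exp (-(m * z)) = exp (M * z) * exp (-(2 * κ * z)) := by rw [← exp_add, hκ]; ring_nf
    rw [e2]
    simp only [Kp]; ring
  simp_rw [e]
  have i3 : IntegrableOn (fun z => exp t * (φ₁ (t, z) * exp (-(m * z))) + exp t * (φ₂ (t, z) * exp (-(m * z)))) (Ioi 0) :=
    (i1.const_mul _).add (i2.const_mul _)
  rw [integral_add i3 (s1.const_mul _),
    integral_add (i1.const_mul _) (i2.const_mul _), integral_const_mul, integral_const_mul, integral_const_mul, s2]
  simp only [gL, ← hI₁, ← hI₂]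
  have : exp (2 * t) = exp t * exp t := by rw [← exp_add]; ring_nf
  rw [this]; ring

def Topr (K : ℝ × ℝ → ℝ) (p : ℝ → ℝ) (s : ℝ) : ℝ := p s + ∫ t in (0:ℝ)..s, p t * K (t, s - t)

lemma int_gg {Q₁ Q₂ : ℝ → ℝ} {C M : ℝ} {φ₁ φ₂ : ℝ × ℝ → ℝ} {R₁ R₂ : ℝ} (h₁ : KerData Q₁ C M φ₁ R₁)
    (h₂ : KerData Q₂ C M φ₂ R₂) {m κ : ℝ} (hm : 2 ≤ m) (hκ : 2 * κ = m + M) (hκ2 : 2 ≤ κ) :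
    let p := fun s => Q₁ s - Q₂ s
    IntegrableOn (fun s => Topr (Kp M φ₁ φ₂) p s * exp (-(2 * κ * s))) (Ioi 0) ∧
    ∫ s in Ioi (0:ℝ), Topr (Kp M φ₁ φ₂) p s * exp (-(2 * κ * s)) =
      ∫ t in Ioi (0:ℝ), p t * (exp (-(2 * κ * t)) * (gL φ₁ m t * gL φ₂ m t)) := by
  intro p
  have hKc := Kp_cont M h₁.cont h₂.cont
  have hp2 : IntegrableOn (fun t => p t * exp (-(2 * t))) (Ioi 0) := by
    refine (h₁.ul.int2.sub h₂.ul.int2).congr ?_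
    filter_upwards with t
    simp only [p, Pi.sub_apply]; ring
  have hpm : Measurable p := h₁.ul.meas.sub h₂.ul.meas
  set Φ : ℝ → ℝ → ℝ := fun t z => p t * exp (-(2 * κ * t)) * (Kp M φ₁ φ₂ (t, z) * exp (-(2 * κ * z))) with hΦ
  have hpκ : IntegrableOn (fun t => p t * exp (-(2 * κ * t))) (Ioi 0) := by
    refine Integrable.mono' hp2.norm (by fun_prop) ?_
    filter_upwards [ae_restrict_mem measurableSet_Ioi] with t ht
    have ht' : 0 < t := ht
    rw [norm_mul, norm_mul]
    refine mul_le_mul_of_nonneg_left ?_ (norm_nonneg _)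
    rw [Real.norm_eq_abs, Real.norm_eq_abs, abs_of_pos (exp_pos _), abs_of_pos (exp_pos _)]
    exact exp_le_exp.2 (by nlinarith)
  have hΦi : Integrable (Function.uncurry Φ) ((volume.restrict (Ioi 0)).prod (volume.restrict (Ioi 0))) := by
    have j1 : Integrable (fun q : ℝ × ℝ => (R₁ + R₂ + R₁ * R₂) * (‖p q.1 * exp (-(2 * q.1))‖ * exp (-((m - 1) * q.2))))
        ((volume.restrict (Ioi 0)).prod (volume.restrict (Ioi 0))) :=
      (Integrable.mul_prod hp2.norm (int_exp_neg (by linarith))).const_mul _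
    refine Integrable.mono' j1 ?_ ?_
    · have : Measurable (Function.uncurry Φ) := by
        simp only [hΦ, Function.uncurry_def]
        have := hKc.measurable
        fun_prop
      exact this.aestronglyMeasurable
    · rw [Measure.prod_restrict]
      filter_upwards [ae_restrict_mem (measurableSet_Ioi.prod measurableSet_Ioi)] with q hq
      have hq1 : 0 < q.1 := hq.1
      have hq2 : 0 < q.2 := hq.2
      have b := Kp_bd M h₁.bd h₂.bd hq1.le hq2.le
      simp only [Function.uncurry, hΦ]
      rw [norm_mul, norm_mul, norm_mul, norm_mul]
      simp only [Real.norm_eq_abs, abs_of_pos (exp_pos _)]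
      have r1 := h₁.R0
      have r2 := h₂.R0
      have x1 : exp (-(2 * κ * q.1)) * exp (2 * q.1) ≤ exp (-(2 * q.1)) := by
        rw [← exp_add]; exact exp_le_exp.2 (by nlinarith)
      have x2 : exp ((M + 1) * q.2) * exp (-(2 * κ * q.2)) = exp (-((m - 1) * q.2)) := by
        rw [← exp_add, hκ]; ring_nf
      calc |p q.1| * exp (-(2 * κ * q.1)) * (|Kp M φ₁ φ₂ (q.1, q.2)| * exp (-(2 * κ * q.2)))
          ≤ |p q.1| * exp (-(2 * κ * q.1)) * (((R₁ + R₂ + R₁ * R₂) * exp (2 * q.1) * exp ((M + 1) * q.2)) * exp (-(2 * κ * q.2))) := by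
            gcongr
        _ = (R₁ + R₂ + R₁ * R₂) * (|p q.1| * (exp (-(2 * κ * q.1)) * exp (2 * q.1)) * (exp ((M + 1) * q.2) * exp (-(2 * κ * q.2)))) := by ring
        _ ≤ _ := by rw [x2]; gcongr
  obtain ⟨s1, s2⟩ := shear hΦi
  have e1 : ∀ s, Topr (Kp M φ₁ φ₂) p s * exp (-(2 * κ * s)) = p s * exp (-(2 * κ * s)) + ∫ τ in (0:ℝ)..s, Φ τ (s - τ) := by
    intro s
    rw [Topr, add_mul, mul_comm (∫ t in (0:ℝ)..s, p t * Kp M φ₁ φ₂ (t, s - t)), ← intervalIntegral.integral_const_mul]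
    congr 1
    refine intervalIntegral.integral_congr fun τ _ => ?_
    have : exp (-(2 * κ * s)) = exp (-(2 * κ * τ)) * exp (-(2 * κ * (s - τ))) := by rw [← exp_add]; ring_nf
    simp only [this, hΦ]; ring
  have hsum := hpκ.add s1
  constructor
  · exact hsum.congr (by filter_upwards with s; rw [e1 s]; rfl)
  · simp_rw [e1]
    rw [integral_add hpκ s1, s2]
    have s3 : IntegrableOn (fun τ => ∫ z in Ioi (0:ℝ), Φ τ z) (Ioi 0) := hΦi.integral_prod_left
    rw [← integral_add hpκ s3]
    refine integral_congr_ae ?_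
    filter_upwards with t
    rw [gg_eq h₁ h₂ hm hκ t]
    simp only [hΦ]
    rw [integral_const_mul]; ring

lemma Topr_zero_iff {K : ℝ × ℝ → ℝ} (hK : Continuous K) {p : ℝ → ℝ} (hp : ∀ a b, IntervalIntegrable p volume a b)
    {a : ℝ} (ha : 0 < a) :
    (∀ᵐ s ∂(volume.restrict (Ioo 0 a)), Topr K p s = 0) ↔ (∀ᵐ s ∂(volume.restrict (Ioo 0 a)), p s = 0) := by
  constructor
  · intro h
    obtain ⟨B, hB⟩ : ∃ B, ∀ x ∈ (Icc (0:ℝ) a) ×ˢ (Icc (0:ℝ) a), ‖K x‖ ≤ B :=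
      (isCompact_Icc.prod isCompact_Icc).exists_bound_of_continuousOn hK.continuousOn
    have hB0 : 0 ≤ B := (norm_nonneg _).trans (hB (0, 0) ⟨⟨le_rfl, ha.le⟩, ⟨le_rfl, ha.le⟩⟩)
    set φ : ℝ → ℝ := fun x => ∫ s in (0:ℝ)..x, |p s| with hφ
    have hφc : Continuous φ := intervalIntegral.continuous_primitive (fun a b => (hp a b).abs) 0
    rw [ae_restrict_iff' measurableSet_Ioo] at h
    have hne : ∀ᵐ s : ℝ, s ≠ a := by simp [ae_iff]
    have hpb : ∀ᵐ s : ℝ, s ∈ Ioc 0 a → |p s| ≤ B * φ s := by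
      filter_upwards [h, hne] with s hs hsa hs0
      have hs' : s ∈ Ioo 0 a := ⟨hs0.1, lt_of_le_of_ne hs0.2 hsa⟩
      have := hs hs'
      rw [Topr] at this
      rw [eq_neg_of_add_eq_zero_left this, abs_neg]
      have h2 : |∫ t in (0:ℝ)..s, p t * K (t, s - t)| ≤ ∫ t in (0:ℝ)..s, B * |p t| := by
        refine abs_int_le hs0.1.le ?_ ((hp _ _).abs.const_mul B)
        filter_upwards with t ht
        rw [norm_mul, mul_comm, Real.norm_eq_abs (p t)]
        refine mul_le_mul_of_nonneg_right (hB _ ⟨⟨ht.1.le, ht.2.trans hs0.2⟩, ⟨?_, ?_⟩⟩) (abs_nonneg _)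
        · simp only; linarith [ht.2]
        · simp only; linarith [ht.1, hs0.2]
      rw [intervalIntegral.integral_const_mul] at h2
      exact h2
    have hg := gronwall_zero ha.le (φ := φ) (k := fun _ => B) hφc.continuousOn ?_ intervalIntegrable_const
      (fun _ _ => hB0) ?_
    · rw [ae_restrict_iff' measurableSet_Ioo]
      filter_upwards [hpb] with s hs hs'
      have := hs (Ioo_subset_Ioc_self hs')
      rw [hg s (Ioo_subset_Icc_self hs'), mul_zero] at this
      exact abs_eq_zero.1 (le_antisymm this (abs_nonneg _))
    · intro t ht
      exact intervalIntegral.integral_nonneg ht.1 fun _ _ => abs_nonneg _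
    · intro t ht
      refine intervalIntegral.integral_mono_ae_restrict ht.1 (hp _ _).abs (Continuous.intervalIntegrable (by fun_prop) _ _) ?_
      have : ∀ᵐ s : ℝ, s ∈ Icc 0 t → |p s| ≤ B * φ s := by
        have hn0 : ∀ᵐ s : ℝ, s ≠ 0 := by simp [ae_iff]
        filter_upwards [hpb, hn0] with s hs h0 hst
        exact hs ⟨lt_of_le_of_ne hst.1 (Ne.symm h0), hst.2.trans ht.2⟩
      exact (ae_restrict_iff' measurableSet_Icc).2 this
  · intro h
    have h' := h
    rw [ae_restrict_iff' measurableSet_Ioo] at h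
    filter_upwards [h', ae_restrict_mem measurableSet_Ioo] with s hs hs'
    rw [Topr, hs, zero_add]
    rw [intervalIntegral.integral_congr_ae (g := fun _ => (0:ℝ))]
    · simp
    · filter_upwards [h] with t ht htt
      rw [uIoc_of_le hs'.1.le] at htt
      rw [ht ⟨htt.1, htt.2.trans_lt hs'.2⟩, zero_mul]

/-- Data of a normalized decaying solution. -/
structure DecSol (Q : ℝ → ℝ) (κ : ℝ) (u v : ℝ → ℝ) (D : ℝ) : Prop where
  sol : TSol Q κ u v
  u0 : u 0 = 1
  dec : ∀ t, 0 ≤ t → |u t| ≤ D * exp (-((κ - 1) * t)) ∧ |v t| ≤ D * exp (-((κ - 1) * t))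

theorem tworld {Q₁ Q₂ : ℝ → ℝ} {C₁ C₂ : ℝ} (h₁ : ULQ Q₁ C₁) (h₂ : ULQ Q₂ C₂) :
    ∃ (K0 : ℝ) (K : ℝ × ℝ → ℝ), 2 ≤ K0 ∧ Continuous K ∧ ∀ κ, K0 ≤ κ →
      ∃ u₁ v₁ D₁ u₂ v₂ D₂, DecSol Q₁ κ u₁ v₁ D₁ ∧ DecSol Q₂ κ u₂ v₂ D₂ ∧
        IntegrableOn (fun s => Topr K (fun s => Q₁ s - Q₂ s) s * exp (-(2 * κ * s))) (Ioi 0) ∧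
        ∫ s in Ioi (0:ℝ), Topr K (fun s => Q₁ s - Q₂ s) s * exp (-(2 * κ * s)) = v₂ 0 - v₁ 0 := by
  set C := max C₁ C₂ with hC
  have g₁ := h₁.mono (le_max_left C₁ C₂)
  have g₂ := h₂.mono (le_max_right C₁ C₂)
  rw [← hC] at g₁ g₂
  have hC0 := g₁.C0
  obtain ⟨φ₁, R₁, c₁, b₁, e₁⟩ := exists_kernel g₁
  obtain ⟨φ₂, R₂, c₂, b₂, e₂⟩ := exists_kernel g₂
  set M := 2 + 4 * C with hM
  have k₁ : KerData Q₁ C M φ₁ R₁ := ⟨g₁, by linarith, c₁, b₁, e₁⟩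
  have k₂ : KerData Q₂ C M φ₂ R₂ := ⟨g₂, by linarith, c₂, b₂, e₂⟩
  refine ⟨M + 2, Kp M φ₁ φ₂, by linarith, Kp_cont M c₁ c₂, fun κ hκ => ?_⟩
  have hm : 2 ≤ 2 * κ - M := by linarith
  have hκ2 : 2 ≤ κ := by linarith
  have hmk : 2 * κ = (2 * κ - M) + M := by ring
  obtain ⟨u₁, v₁, s₁, z₁, f₁, D₁, hD₁, d₁⟩ := k₁.exists_sol (by linarith) hmk
  obtain ⟨u₂, v₂, s₂, z₂, f₂, D₂, hD₂, d₂⟩ := k₂.exists_sol (by linarith) hmk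
  obtain ⟨i1, i2⟩ := int_gg k₁ k₂ hm hmk hκ2
  refine ⟨u₁, v₁, D₁, u₂, v₂, D₂, ⟨s₁, z₁, d₁⟩, ⟨s₂, z₂, d₂⟩, i1, ?_⟩
  rw [i2]
  have hp2 : IntegrableOn (fun t => (Q₁ t - Q₂ t) * exp (-(2 * t))) (Ioi 0) := by
    refine (h₁.int2.sub h₂.int2).congr ?_
    filter_upwards with t
    simp only [Pi.sub_apply]; ring
  have hcong : ∫ t in Ioi (0:ℝ), (Q₁ t - Q₂ t) * (exp (-(2 * κ * t)) * (gL φ₁ (2 * κ - M) t * gL φ₂ (2 * κ - M) t)) =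
      ∫ t in Ioi (0:ℝ), (Q₁ t - Q₂ t) * (u₁ t * u₂ t) := by
    refine setIntegral_congr_fun measurableSet_Ioi fun t ht => ?_
    have ht' : 0 ≤ t := le_of_lt ht
    have : exp (-(2 * κ * t)) = exp (-(κ * t)) * exp (-(κ * t)) := by rw [← exp_add]; ring_nf
    simp only [f₁ t ht', f₂ t ht', this]; ring
  rw [hcong]
  have hmul : ∀ a b : ℝ → ℝ, (∀ t, 0 ≤ t → |a t| ≤ D₁ * exp (-((κ - 1) * t))) →
      (∀ t, 0 ≤ t → |b t| ≤ D₂ * exp (-((κ - 1) * t))) → ∀ t, 0 ≤ t → |a t * b t| ≤ D₁ * D₂ * exp (-(2 * t)) := by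
    intro a b ha hb t ht
    rw [abs_mul]
    refine (mul_le_mul (ha t ht) (hb t ht) (abs_nonneg _) (by positivity)).trans ?_
    have : D₁ * exp (-((κ - 1) * t)) * (D₂ * exp (-((κ - 1) * t))) = D₁ * D₂ * exp (-(2 * (κ - 1) * t)) := by
      rw [show -(2 * (κ - 1) * t) = -((κ - 1) * t) + -((κ - 1) * t) by ring, exp_add]; ring
    rw [this]
    exact mul_le_mul_of_nonneg_left (exp_le_exp.2 (by nlinarith)) (by positivity)
  have hpu : IntegrableOn (fun t => (Q₁ t - Q₂ t) * (u₁ t * u₂ t)) (Ioi 0) := by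
    refine Integrable.mono' (hp2.norm.const_mul (D₁ * D₂)) ?_ ?_
    · refine (h₁.meas.sub h₂.meas).aestronglyMeasurable.mul ?_
      exact ((s₁.cu.mul s₂.cu).mono Ioi_subset_Ici_self).aestronglyMeasurable measurableSet_Ioi
    · filter_upwards [ae_restrict_mem measurableSet_Ioi] with t ht
      have := hmul u₁ u₂ (fun t ht => (d₁ t ht).1) (fun t ht => (d₂ t ht).1) t (le_of_lt ht)
      rw [norm_mul (Q₁ t - Q₂ t) (u₁ t * u₂ t), norm_mul (Q₁ t - Q₂ t) (exp _), mul_left_comm]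
      refine mul_le_mul_of_nonneg_left ?_ (norm_nonneg (Q₁ t - Q₂ t))
      rw [Real.norm_eq_abs, Real.norm_eq_abs, abs_of_pos (exp_pos _)]
      exact this
  have l1 := intervalIntegral_tendsto_integral_Ioi 0 hpu Filter.tendsto_id
  have l2 : Filter.Tendsto (fun L => ∫ s in (0:ℝ)..L, (Q₁ s - Q₂ s) * (u₁ s * u₂ s)) Filter.atTop
      (nhds (v₂ 0 - v₁ 0)) := by
    have hE : Filter.Tendsto (fun L : ℝ => D₁ * D₂ * exp (-(2 * L))) Filter.atTop (nhds 0) := by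
      rw [show (0:ℝ) = D₁ * D₂ * 0 by ring]
      refine Filter.Tendsto.const_mul _ ?_
      refine tendsto_exp_neg_atTop_nhds_zero.comp (Filter.tendsto_id.const_mul_atTop (by norm_num : (0:ℝ) < 2))
    have z1 : Filter.Tendsto (fun L => v₁ L * u₂ L) Filter.atTop (nhds 0) := by
      refine squeeze_zero_norm' ?_ hE
      filter_upwards [Filter.eventually_ge_atTop 0] with L hL
      exact hmul v₁ u₂ (fun t ht => (d₁ t ht).2) (fun t ht => (d₂ t ht).1) L hL
    have z2 : Filter.Tendsto (fun L => u₁ L * v₂ L) Filter.atTop (nhds 0) := by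
      refine squeeze_zero_norm' ?_ hE
      filter_upwards [Filter.eventually_ge_atTop 0] with L hL
      exact hmul u₁ v₂ (fun t ht => (d₁ t ht).1) (fun t ht => (d₂ t ht).2) L hL
    have z3 := (z1.sub z2).sub_const (v₁ 0 * u₂ 0 - u₁ 0 * v₂ 0)
    rw [z₁, z₂] at z3
    rw [show v₂ 0 - v₁ 0 = 0 - 0 - (v₁ 0 * 1 - 1 * v₂ 0) by ring]
    refine z3.congr' ?_
    filter_upwards [Filter.eventually_ge_atTop 0] with L hL
    rw [← wronskian h₁.loc h₂.loc s₁ s₂ hL, z₁, z₂]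
  exact tendsto_nhds_unique l1 l2


lemma hasDeriv_expneg (t : ℝ) : HasDerivAt (fun t : ℝ => exp (-t)) (-exp (-t)) t := by
  simpa using (hasDerivAt_neg t).exp

lemma expneg_inj : Function.Injective (fun t : ℝ => exp (-t)) := by
  intro a b h
  have := exp_injective h
  linarith

lemma image_expneg_Icc (a b : ℝ) :
    (fun t : ℝ => exp (-t)) '' Icc a b = Icc (exp (-b)) (exp (-a)) := by
  ext r
  constructor
  · rintro ⟨t, ht, rfl⟩
    exact ⟨exp_le_exp.2 (by linarith [ht.2]), exp_le_exp.2 (by linarith [ht.1])⟩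
  · intro hr
    have h0 : 0 < r := (exp_pos _).trans_le hr.1
    refine ⟨-log r, ⟨?_, ?_⟩, by simp [exp_log h0]⟩
    · have := log_le_log h0 hr.2
      rw [log_exp] at this; linarith
    · have := log_le_log (exp_pos _) hr.1
      rw [log_exp] at this; linarith

lemma image_expneg_Ioo (a b : ℝ) :
    (fun t : ℝ => exp (-t)) '' Ioo a b = Ioo (exp (-b)) (exp (-a)) := by
  ext r
  constructor
  · rintro ⟨t, ht, rfl⟩
    exact ⟨exp_lt_exp.2 (by linarith [ht.2]), exp_lt_exp.2 (by linarith [ht.1])⟩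
  · intro hr
    have h0 : 0 < r := (exp_pos _).trans hr.1
    refine ⟨-log r, ⟨?_, ?_⟩, by simp [exp_log h0]⟩
    · have := log_lt_log h0 hr.2
      rw [log_exp] at this; linarith
    · have := log_lt_log (exp_pos _) hr.1
      rw [log_exp] at this; linarith

lemma image_expneg_Ioi :
    (fun t : ℝ => exp (-t)) '' Ioi 0 = Ioo 0 1 := by
  ext r
  constructor
  · rintro ⟨t, ht, rfl⟩
    exact ⟨exp_pos _, by rw [exp_lt_one_iff]; have : 0 < t := ht; linarith⟩
  · intro hr
    exact ⟨-log r, by simpa using log_neg hr.1 hr.2, by simp [exp_log hr.1]⟩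

lemma image_expneg_univ :
    (fun t : ℝ => exp (-t)) '' univ = Ioi 0 := by
  ext r
  constructor
  · rintro ⟨t, ht, rfl⟩
    exact exp_pos _
  · intro hr
    exact ⟨-log r, mem_univ _, by simp [exp_log hr]⟩

lemma cov_lint {s : Set ℝ} (hs : MeasurableSet s) (G : ℝ → ℝ≥0∞) :
    ∫⁻ r in (fun t : ℝ => exp (-t)) '' s, G r
      = ∫⁻ t in s, ENNReal.ofReal (exp (-t)) * G (exp (-t)) := by
  rw [lintegral_image_eq_lintegral_abs_deriv_mul hs
    (fun x _ => (hasDeriv_expneg x).hasDerivWithinAt) expneg_inj.injOn]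
  simp

lemma cov_int {s : Set ℝ} (hs : MeasurableSet s) (G : ℝ → ℝ) :
    ∫ r in (fun t : ℝ => exp (-t)) '' s, G r
      = ∫ t in s, G (exp (-t)) * exp (-t) := by
  rw [integral_image_eq_integral_abs_deriv_smul hs
    (fun x _ => (hasDeriv_expneg x).hasDerivWithinAt) expneg_inj.injOn]
  simp [mul_comm]

lemma cov_intOn {s : Set ℝ} (hs : MeasurableSet s) (G : ℝ → ℝ) :
    IntegrableOn G ((fun t : ℝ => exp (-t)) '' s)
      ↔ IntegrableOn (fun t => G (exp (-t)) * exp (-t)) s := by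
  rw [integrableOn_image_iff_integrableOn_abs_deriv_smul hs
    (fun x _ => (hasDeriv_expneg x).hasDerivWithinAt) expneg_inj.injOn]
  simp [mul_comm]

lemma cov_interval {a b : ℝ} (hab : a ≤ b) (G : ℝ → ℝ) :
    ∫ r in exp (-b)..exp (-a), G r = ∫ t in a..b, G (exp (-t)) * exp (-t) := by
  rw [intervalIntegral.integral_of_le hab,
    intervalIntegral.integral_of_le (exp_le_exp.2 (by linarith)),
    ← integral_Icc_eq_integral_Ioc, ← integral_Icc_eq_integral_Ioc,
    ← image_expneg_Icc, cov_int measurableSet_Icc]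

lemma ae_expneg {P : ℝ → Prop} (h : ∀ᵐ r ∂(volume.restrict (Ioo (0:ℝ) 1)), P r) :
    ∀ᵐ t ∂(volume.restrict (Ioi (0:ℝ))), P (exp (-t)) := by
  rw [ae_restrict_iff' measurableSet_Ioo] at h
  rw [ae_restrict_iff' measurableSet_Ioi]
  rw [ae_iff] at h ⊢
  have h2 : DifferentiableOn ℝ (fun r => -log r) {a | ¬(a ∈ Ioo (0:ℝ) 1 → P a)} := by
    intro r hr
    simp only [mem_ofPred_eq, Classical.not_imp] at hr
    exact ((differentiableAt_log hr.1.1.ne').neg).differentiableWithinAt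
  refine measure_mono_null ?_ (addHaar_image_eq_zero_of_differentiableOn_of_addHaar_eq_zero volume h2 h)
  intro t ht
  simp only [mem_ofPred_eq, Classical.not_imp] at ht
  refine ⟨exp (-t), ?_, by simp⟩
  simp only [mem_ofPred_eq, Classical.not_imp]
  refine ⟨?_, ht.2⟩
  rw [← image_expneg_Ioi]
  exact ⟨t, ht.1, rfl⟩

def Qof (q : ℝ → ℝ) (t : ℝ) : ℝ := if 0 < t then exp (-(2*t)) * q (exp (-t)) else 0

lemma expneg_mem {t : ℝ} (ht : 0 ≤ t) : exp (-t) ∈ Ioc (0:ℝ) 1 :=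
  ⟨exp_pos _, by rw [exp_le_one_iff]; linarith⟩

lemma radial_to_tsol {d : ℕ} {q : ℝ → ℝ} {k : ℕ} {b b' : ℝ → ℝ}
    (hQ : ∀ x y, IntervalIntegrable (Qof q) volume x y)
    (h : IsRadialSolution d q k b b') {m κ : ℝ} (hm : m = ((d:ℝ) - 2)/2) (hκ : κ = k + m) :
    TSol (Qof q) κ (fun t => exp (-(m*t)) * b (exp (-t)))
      (fun t => -(exp (-(m*t)) * (m * b (exp (-t)) + exp (-t) * b' (exp (-t))))) := by
  obtain ⟨h1, h2, g, hg, h3, h4⟩ := h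
  set u : ℝ → ℝ := fun t => exp (-(m*t)) * b (exp (-t)) with hu
  set v : ℝ → ℝ := fun t => -(exp (-(m*t)) * (m * b (exp (-t)) + exp (-t) * b' (exp (-t)))) with hv
  have maps : MapsTo (fun t : ℝ => exp (-t)) (Ici 0) (Ioc 0 1) := fun t ht => expneg_mem ht
  have cE : Continuous (fun t : ℝ => exp (-t)) := by fun_prop
  have cb : ContinuousOn b (Ioc 0 1) := fun r hr => (h1 r hr).continuousWithinAt
  have cb2 : ContinuousOn (fun t => b (exp (-t))) (Ici 0) := cb.comp cE.continuousOn maps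
  have cb3 : ContinuousOn (fun t => b' (exp (-t))) (Ici 0) := h2.comp cE.continuousOn maps
  have cu : ContinuousOn u (Ici 0) := ContinuousOn.mul (by fun_prop) cb2
  have cv : ContinuousOn v (Ici 0) := by
    apply ContinuousOn.neg
    apply ContinuousOn.mul (by fun_prop)
    apply ContinuousOn.add (ContinuousOn.mul (by fun_prop) cb2)
    exact ContinuousOn.mul (by fun_prop) cb3
  have hd : ∀ t, 0 ≤ t → HasDerivWithinAt u (v t) (Ici 0) t := by
    intro t ht
    have e1 : HasDerivWithinAt (fun t => b (exp (-t))) (b' (exp (-t)) * -exp (-t)) (Ici 0) t :=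
      HasDerivWithinAt.comp t (h1 _ (expneg_mem ht)) (hasDeriv_expneg t).hasDerivWithinAt maps
    have e2 : HasDerivWithinAt (fun t : ℝ => exp (-(m*t))) (exp (-(m*t)) * -(m*1)) (Ici 0) t :=
      (((hasDerivAt_id t).const_mul m).neg.exp).hasDerivWithinAt
    refine (e2.mul e1).congr_deriv ?_
    simp only [hv]; ring
  refine ⟨hd, cv, ?_⟩
  intro t ht
  set P : ℝ → ℝ := fun t => exp (-t) ^ ((d:ℝ) - 1) * b' (exp (-t)) with hP
  have iu : ∀ s, 0 ≤ s → u s = u 0 + ∫ x in (0:ℝ)..s, v x := by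
    intro s hs
    have := intervalIntegral.integral_eq_sub_of_hasDeriv_right_of_le (f := u) (f' := v) hs
      (cu.mono Icc_subset_Ici_self)
      (fun x hx => (hd x hx.1.le).mono (fun y hy => hx.1.le.trans (le_of_lt hy)))
      (ContinuousOn.intervalIntegrable (by rw [uIcc_of_le hs]; exact cv.mono Icc_subset_Ici_self))
    linarith
  have hgI : ∀ s, 0 ≤ s → IntervalIntegrable (fun x => g (exp (-x)) * exp (-x)) volume 0 s := by
    intro s hs
    rw [intervalIntegrable_iff_integrableOn_Icc_of_le hs, ← cov_intOn measurableSet_Icc,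
      image_expneg_Icc]
    refine hg.integrableOn_compact_subset ?_ isCompact_Icc
    intro r hr
    exact ⟨(exp_pos _).trans_le hr.1, by simpa using hr.2⟩
  have iP : ∀ s, 0 ≤ s → P s = P 0 + ∫ x in (0:ℝ)..s, -(g (exp (-x)) * exp (-x)) := by
    intro s hs
    have := h3 _ (expneg_mem hs) _ (expneg_mem le_rfl) (exp_le_exp.2 (by linarith))
    rw [cov_interval hs] at this
    rw [intervalIntegral.integral_neg]
    simp only [hP]
    linarith
  have vform : ∀ s, v s = -(m * u s + exp (m*s) * P s) := by
    intro s
    simp only [hv, hu, hP, ← exp_mul]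
    have : exp (m*s) * exp (-s * ((d:ℝ)-1)) = exp (-(m*s)) * exp (-s) := by
      rw [← exp_add, ← exp_add]; congr 1; rw [hm]; ring
    linear_combination (b' (exp (-s))) * this
  have cs : ContinuousOn v (uIcc 0 t) := by
    rw [uIcc_of_le ht]; exact cv.mono Icc_subset_Ici_self
  have ap := ac_prod_rule ht (A := fun s => exp (m*s)) (B := P) (α := fun s => m * exp (m*s))
    (β := fun x => -(g (exp (-x)) * exp (-x)))
    (Continuous.intervalIntegrable (by fun_prop) _ _) (hgI t ht).neg
    (fun s hs => by
      have := intervalIntegral.integral_eq_sub_of_hasDerivAt (a := 0) (b := s)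
        (f := fun s => exp (m*s)) (f' := fun s => m * exp (m*s))
        (fun x _ => ((((hasDerivAt_id x).const_mul m).exp).congr_deriv (by simp; ring)))
        (Continuous.intervalIntegrable (by fun_prop) _ _)
      linarith)
    (fun s hs => iP s hs.1)
  have key : ∀ᵐ s, s ∈ uIoc 0 t → (κ^2 + Qof q s) * u s =
      -(m * v s) - (m * exp (m*s) * P s + exp (m*s) * -(g (exp (-s)) * exp (-s))) := by
    have := ae_expneg h4
    rw [ae_restrict_iff' measurableSet_Ioi] at this
    filter_upwards [this] with s hs hs2
    rw [uIoc_of_le ht] at hs2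
    have hs3 := hs hs2.1
    have hpos : (0:ℝ) < exp (-s) ^ ((d:ℝ)-1) := rpow_pos_of_pos (exp_pos _) _
    have hg2 : g (exp (-s)) = exp (-s) ^ ((d:ℝ)-1) *
      (((k:ℝ) * ((k:ℝ) + (d:ℝ) - 2)) / exp (-s) ^ 2 + q (exp (-s))) * b (exp (-s)) := by
      have : g (exp (-s)) / exp (-s) ^ ((d:ℝ)-1) =
        (((k:ℝ) * ((k:ℝ) + (d:ℝ) - 2)) / exp (-s) ^ 2 + q (exp (-s))) * b (exp (-s)) := by
        rw [neg_div] at hs3; linarith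
      rw [div_eq_iff hpos.ne'] at this
      rw [this]; ring
    have hk : (k:ℝ) * ((k:ℝ) + (d:ℝ) - 2) = κ^2 - m^2 := by rw [hκ, hm]; ring
    rw [vform, hg2, hk, ← exp_mul]
    have e1 : ((exp (-s))^2)⁻¹ = exp (2*s) := by
      rw [← exp_nat_mul, ← exp_neg]; congr 1; push_cast; ring
    have e2 : exp (m*s) * exp (-s * ((d:ℝ)-1)) * exp (-s) * exp (2*s) = exp (-(m*s)) := by
      rw [← exp_add, ← exp_add, ← exp_add]; congr 1; rw [hm]; ring
    have e3 : exp (m*s) * exp (-s * ((d:ℝ)-1)) * exp (-s) = exp (-(m*s)) * exp (-(2*s)):= by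
      rw [← exp_add, ← exp_add, ← exp_add]; congr 1; rw [hm]; ring
    rw [div_eq_mul_inv, e1, Qof, if_pos hs2.1]
    simp only [hu]
    linear_combination (-(κ^2-m^2) * b (exp (-s))) * e2 - q (exp (-s)) * b (exp (-s)) * e3
  rw [intervalIntegral.integral_congr_ae key]
  have i1 : IntervalIntegrable (fun s => -(m * v s)) volume 0 t :=
    (cs.intervalIntegrable.const_mul m).neg
  have cP : ContinuousOn P (uIcc 0 t) := by
    rw [uIcc_of_le ht]
    refine ContinuousOn.mul ?_ (cb3.mono Icc_subset_Ici_self)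
    simp only [← exp_mul]; fun_prop
  have i2 : IntervalIntegrable
      (fun s => m * exp (m*s) * P s + exp (m*s) * -(g (exp (-s)) * exp (-s))) volume 0 t := by
    refine IntervalIntegrable.add ?_ ?_
    · apply ContinuousOn.intervalIntegrable
      exact ContinuousOn.mul (by fun_prop) cP
    · exact (hgI t ht).neg.continuousOn_mul (by fun_prop)
  rw [intervalIntegral.integral_sub i1 i2, ← ap, intervalIntegral.integral_neg,
    intervalIntegral.integral_const_mul]
  rw [vform t, vform 0]
  linear_combination (-m) * iu t ht


lemma neglog_nonneg {r : ℝ} (hr : r ∈ Ioc (0:ℝ) 1) : 0 ≤ -log r := by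
  have := log_nonpos hr.1.le hr.2
  linarith

lemma tsol_to_radial {d : ℕ} {q : ℝ → ℝ} {k : ℕ} {u v : ℝ → ℝ} {m κ : ℝ}
    (hQ : ∀ x y, IntervalIntegrable (Qof q) volume x y)
    (h : TSol (Qof q) κ u v) (hm : m = ((d:ℝ) - 2)/2) (hκ : κ = k + m) :
    IsRadialSolution d q k (fun r => exp (m * (-log r)) * u (-log r))
      (fun r => -(exp ((m+1) * (-log r)) * (m * u (-log r) + v (-log r)))) := by
  have maps : MapsTo (fun r : ℝ => -log r) (Ioc 0 1) (Ici 0) := fun r hr => neglog_nonneg hr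
  have cL : ContinuousOn (fun r : ℝ => -log r) (Ioc 0 1) :=
    (continuousOn_log.mono (fun r hr => hr.1.ne')).neg
  have cu2 : ContinuousOn (fun r => u (-log r)) (Ioc 0 1) := h.cu.comp cL maps
  have cv2 : ContinuousOn (fun r => v (-log r)) (Ioc 0 1) := h.cv.comp cL maps
  set G : ℝ → ℝ := fun t => exp (-(m*t)) * ((κ^2 - m^2 + Qof q t) * u t) with hG
  set Y : ℝ → ℝ := fun t => exp (-(m*t)) * (m * u t + v t) with hY
  set g : ℝ → ℝ := fun r => r ^ ((d:ℝ)-1) * (((k:ℝ) * ((k:ℝ) + (d:ℝ) - 2)) / r ^ 2 + q r) *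
    (exp (m * (-log r)) * u (-log r)) with hg
  have hgG : ∀ t, 0 < t → g (exp (-t)) * exp (-t) = G t := by
    intro s hs
    have hk : (k:ℝ) * ((k:ℝ) + (d:ℝ) - 2) = κ^2 - m^2 := by rw [hκ, hm]; ring
    simp only [hg, hG, hk, ← exp_mul, log_exp, neg_neg]
    have e1 : ((exp (-s))^2)⁻¹ = exp (2*s) := by
      rw [← exp_nat_mul, ← exp_neg]; congr 1; push_cast; ring
    have e2 : exp (m*s) * exp (-s * ((d:ℝ)-1)) * exp (-s) * exp (2*s) = exp (-(m*s)) := by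
      rw [← exp_add, ← exp_add, ← exp_add]; congr 1; rw [hm]; ring
    have e3 : exp (m*s) * exp (-s * ((d:ℝ)-1)) * exp (-s) = exp (-(m*s)) * exp (-(2*s)):= by
      rw [← exp_add, ← exp_add, ← exp_add]; congr 1; rw [hm]; ring
    rw [div_eq_mul_inv, e1, Qof, if_pos hs]
    linear_combination ((κ^2-m^2) * u s) * e2 + q (exp (-s)) * u s * e3
  have iQu : ∀ t, 0 ≤ t → IntervalIntegrable (fun s => (κ^2 + Qof q s) * u s) volume 0 t := by
    intro t ht
    refine IntervalIntegrable.mul_continuousOn ?_ (TSol.contIcc h.cu t ht)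
    exact (intervalIntegrable_const).add (hQ _ _)
  have iG : ∀ t, 0 ≤ t → IntervalIntegrable G volume 0 t := by
    intro t ht
    refine IntervalIntegrable.continuousOn_mul ?_ (by fun_prop)
    refine IntervalIntegrable.mul_continuousOn ?_ (TSol.contIcc h.cu t ht)
    exact (intervalIntegrable_const).add (hQ _ _)
  have hYG : ∀ t, 0 ≤ t → Y t = Y 0 + ∫ s in (0:ℝ)..t, G s := by
    intro t ht
    have ap := ac_prod_rule ht (A := fun s => exp (-(m*s))) (B := fun t => m * u t + v t)
      (α := fun s => -(m * exp (-(m*s)))) (β := fun s => m * v s + (κ^2 + Qof q s) * u s)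
      (Continuous.intervalIntegrable (by fun_prop) _ _)
      (((TSol.contIcc h.cv t ht).intervalIntegrable.const_mul m).add (iQu t ht))
      (fun s hs => by
        have := intervalIntegral.integral_eq_sub_of_hasDerivAt (a := 0) (b := s)
          (f := fun s => exp (-(m*s))) (f' := fun s => -(m * exp (-(m*s))))
          (fun x _ => ((((hasDerivAt_id x).const_mul m).neg.exp).congr_deriv (by simp; ring)))
          (Continuous.intervalIntegrable (by fun_prop) _ _)
        linarith)
      (fun s hs => by
        rw [intervalIntegral.integral_add
          ((TSol.contIcc h.cv s hs.1).intervalIntegrable.const_mul m) (iQu s hs.1),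
          intervalIntegral.integral_const_mul]
        linear_combination m * h.i hs.1 + h.e s hs.1)
    have : ∫ s in (0:ℝ)..t, G s = ∫ s in (0:ℝ)..t, (-(m * exp (-(m*s))) * (m * u s + v s) +
        exp (-(m*s)) * (m * v s + (κ^2 + Qof q s) * u s)) := by
      congr 1; ext s; simp only [hG]; ring
    rw [this, ← ap]; ring
  have gae : ∀ a b, 0 ≤ a → a ≤ b → ∀ᵐ t, t ∈ uIoc a b → g (exp (-t)) * exp (-t) = G t := by
    intro a b ha hab
    refine Filter.Eventually.of_forall fun t ht => ?_
    rw [uIoc_of_le hab] at ht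
    exact hgG t (ha.trans_lt ht.1)
  refine ⟨?_, ?_, g, ?_, ?_, ?_⟩
  · intro r hr
    have e0 : HasDerivWithinAt (fun r : ℝ => -log r) (-r⁻¹) (Ioc 0 1) r :=
      (hasDerivAt_log hr.1.ne').neg.hasDerivWithinAt
    have e1 : HasDerivWithinAt (fun r => u (-log r)) (v (-log r) * -r⁻¹) (Ioc 0 1) r :=
      HasDerivWithinAt.comp r (h.d _ (neglog_nonneg hr)) e0 maps
    have e2 : HasDerivWithinAt (fun r => exp (m * (-log r))) (exp (m * (-log r)) * (m * -r⁻¹)) (Ioc 0 1) r :=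
      (e0.const_mul m).exp
    refine (e2.mul e1).congr_deriv ?_
    have : exp ((m+1) * (-log r)) = exp (m * (-log r)) * r⁻¹ := by
      rw [add_mul, exp_add, one_mul, exp_neg (log r), exp_log hr.1]
    beta_reduce; rw [this]; ring
  · apply ContinuousOn.neg
    refine ContinuousOn.mul ?_ ((cu2.const_smul m).add cv2)
    exact (cL.const_smul (m+1)).rexp
  · intro x hx
    refine ⟨Icc (x/2) 1, ?_, ?_⟩
    · rw [mem_nhdsWithin]
      exact ⟨Ioi (x/2), isOpen_Ioi, by have := hx.1; simp only [mem_Ioi]; linarith,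
        fun y hy => ⟨le_of_lt hy.1, hy.2.2⟩⟩
    · have hx2 : x/2 ∈ Ioc (0:ℝ) 1 := ⟨by linarith [hx.1], by linarith [hx.2, hx.1]⟩
      have e : Icc (x/2) 1 = (fun t : ℝ => exp (-t)) '' Icc 0 (-log (x/2)) := by
        rw [image_expneg_Icc]; simp [exp_log hx2.1]
      rw [e, cov_intOn measurableSet_Icc,
        ← intervalIntegrable_iff_integrableOn_Icc_of_le (neglog_nonneg hx2)]
      refine (iG _ (neglog_nonneg hx2)).congr_ae ?_
      rw [Filter.EventuallyEq, ae_restrict_iff' measurableSet_uIoc]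
      filter_upwards [gae 0 _ le_rfl (neglog_nonneg hx2)] with t ht h1
      exact (ht h1).symm
  · intro r₁ hr₁ r₂ hr₂ h12
    have form : ∀ r ∈ Ioc (0:ℝ) 1, r ^ ((d:ℝ)-1) *
        -(exp ((m+1) * (-log r)) * (m * u (-log r) + v (-log r))) = - Y (-log r) := by
      intro r hr
      simp only [hY]
      rw [rpow_def_of_pos hr.1]
      have : exp (log r * ((d:ℝ)-1)) * exp ((m+1) * (-log r)) = exp (-(m * -log r)) := by
        rw [← exp_add]; congr 1; rw [hm]; ring
      linear_combination (-(m * u (-log r) + v (-log r))) * this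
    rw [form r₁ hr₁, form r₂ hr₂]
    have hl : -log r₂ ≤ -log r₁ := neg_le_neg (log_le_log hr₁.1 h12)
    have c := cov_interval hl g
    rw [neg_neg, neg_neg, exp_log hr₁.1, exp_log hr₂.1] at c
    rw [c, intervalIntegral.integral_congr_ae (gae _ _ (neglog_nonneg hr₂) hl)]
    have s := intervalIntegral.integral_interval_sub_left (iG _ (neglog_nonneg hr₁)) (iG _ (neglog_nonneg hr₂))
    rw [← s]
    linear_combination hYG _ (neglog_nonneg hr₁) - hYG _ (neglog_nonneg hr₂)
  · filter_upwards [ae_restrict_mem measurableSet_Ioo] with r hr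
    have hpos : (0:ℝ) < r ^ ((d:ℝ)-1) := rpow_pos_of_pos hr.1 _
    simp only [hg]
    field_simp
    ring

lemma l2_transfer {d : ℕ} {b : ℝ → ℝ} {m : ℝ} (hm : m = ((d:ℝ) - 2)/2) :
    ∫⁻ r in Ioo (0:ℝ) 1, ENNReal.ofReal ((b r) ^ 2 * r ^ ((d:ℝ) - 2))
      = ∫⁻ t in Ioi (0:ℝ), ENNReal.ofReal ((exp (-(m*t)) * b (exp (-t)))^2 * exp (-t)) := by
  rw [← image_expneg_Ioi, cov_lint measurableSet_Ioi]
  refine lintegral_congr fun t => ?_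
  rw [← ENNReal.ofReal_mul (exp_pos _).le, ← exp_mul]
  congr 1
  have : exp (-t * ((d:ℝ)-2)) = exp (-(m*t)) ^ 2 := by
    rw [← exp_nat_mul]; congr 1; rw [hm]; push_cast; ring
  rw [this]; ring

lemma l2_int {u : ℝ → ℝ} (hu : ContinuousOn u (Ici 0)) :
    (∫⁻ t in Ioi (0:ℝ), ENNReal.ofReal (u t ^ 2 * exp (-t))) < ⊤ ↔
      IntegrableOn (fun t => u t ^ 2 * exp (-t)) (Ioi 0) := by
  have hc : ContinuousOn (fun t => u t ^ 2 * exp (-t)) (Ioi 0) := by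
    have := hu.mono Ioi_subset_Ici_self
    fun_prop
  have hm := hc.aestronglyMeasurable (μ := volume) measurableSet_Ioi
  rw [IntegrableOn, Integrable, hasFiniteIntegral_iff_ofReal
    (Filter.Eventually.of_forall fun t => by positivity)]
  exact ⟨fun h => ⟨hm, h⟩, fun h => h.2⟩

lemma dtn_to_t {d : ℕ} {q : ℝ → ℝ} {k : ℕ} {c c' : ℝ → ℝ} {m κ : ℝ}
    (hQ : ∀ x y, IntervalIntegrable (Qof q) volume x y)
    (hm : m = ((d:ℝ) - 2)/2) (hκ : κ = k + m) (h : IsDtNSolution d q k c c') :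
    ∃ w z, TSol (Qof q) κ w z ∧ w 0 = 1 ∧ IntegrableOn (fun t => w t ^ 2 * exp (-t)) (Ioi 0) ∧
      z 0 = -(m + c' 1) ∧ (∀ t, w t = exp (-(m*t)) * c (exp (-t))) := by
  obtain ⟨h1, h2, h3⟩ := h
  have s := radial_to_tsol hQ h1 hm hκ
  refine ⟨_, _, s, by simp [h2], ?_, by simp [h2], fun t => rfl⟩
  rw [← l2_int s.cu, ← l2_transfer hm]
  exact h3

lemma gen_eig {d : ℕ} {q : ℝ → ℝ} {k : ℕ} {m κ lam D : ℝ} {u v : ℝ → ℝ}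
    (hQ : ∀ x y, IntervalIntegrable (Qof q) volume x y)
    (hm : m = ((d:ℝ) - 2)/2) (hκ : κ = k + m) (hk2 : 2 ≤ κ)
    (hs : DecSol (Qof q) κ u v D) (h : IsGenEigenvalue d q k lam) :
    lam = -(m + v 0) := by
  -- decaying solution is square integrable
  have iu : IntegrableOn (fun t => u t ^ 2 * exp (-t)) (Ioi 0) := by
    refine int_of_exp_bd (D := D^2) (a := 1) ?_ one_pos ?_
    · have : ContinuousOn u (Ioi 0) := hs.sol.cu.mono Ioi_subset_Ici_self
      refine ContinuousOn.aestronglyMeasurable ?_ measurableSet_Ioi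
      fun_prop
    · intro t ht
      have := (hs.dec t ht.le).1
      have hD : |u t| ≤ D := by
        have hD0 : 0 ≤ D := by
          have := (hs.dec 0 le_rfl).1
          simp at this
          exact (abs_nonneg _).trans this
        refine this.trans ?_
        have : exp (-((κ-1)*t)) ≤ 1 := by
          rw [exp_le_one_iff]
          have : 0 ≤ (κ-1)*t := mul_nonneg (by linarith) ht.le
          linarith
        nlinarith
      rw [abs_of_nonneg (by positivity), one_mul]
      refine mul_le_mul_of_nonneg_right ?_ (exp_pos _).le
      exact sq_le_sq' (by linarith [abs_le.1 hD]) (abs_le.1 hD).2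
  set b : ℝ → ℝ := fun r => exp (m * (-log r)) * u (-log r) with hb
  set b' : ℝ → ℝ := fun r => -(exp ((m+1) * (-log r)) * (m * u (-log r) + v (-log r))) with hb'
  have hub : ∀ t, exp (-(m*t)) * b (exp (-t)) = u t := by
    intro t
    simp only [hb, log_exp, neg_neg]
    rw [← mul_assoc, ← exp_add]; simp
  have bD : IsDtNSolution d q k b b' := by
    refine ⟨tsol_to_radial hQ hs.sol hm hκ, by simp [hb, hs.u0], ?_⟩
    rw [l2_transfer hm]
    simp only [hub]
    rw [l2_int hs.sol.cu]
    exact iu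
  have uniq : ∀ c c', IsDtNSolution d q k c c' → EqOn c b (Ioc 0 1) := by
    intro c c' hc
    obtain ⟨w, z, hw, hw0, hw2, -, hwc⟩ := dtn_to_t hQ hm hκ hc
    have hdiff := TSol.sub hQ hw hs.sol
    have hdi : IntegrableOn (fun t => (w t - u t) ^ 2 * exp (-t)) (Ioi 0) := by
      refine Integrable.mono' ((hw2.const_mul 2).add (iu.const_mul 2)) ?_ ?_
      · refine ContinuousOn.aestronglyMeasurable ?_ measurableSet_Ioi
        have a1 : ContinuousOn u (Ioi 0) := hs.sol.cu.mono Ioi_subset_Ici_self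
        have a2 : ContinuousOn w (Ioi 0) := hw.cu.mono Ioi_subset_Ici_self
        fun_prop
      · refine Filter.Eventually.of_forall fun t => ?_
        rw [norm_of_nonneg (by positivity)]
        have := exp_pos (-t)
        simp only [Pi.add_apply]
        nlinarith [mul_nonneg (sq_nonneg (w t + u t)) this.le]
    have z0 := TSol.uniq_zero hQ hk2 hs.sol hs.u0 hs.dec hdiff (by simp [hw0, hs.u0]) hdi
    intro r hr
    have e := z0 (-log r) (neglog_nonneg hr)
    have e2 := hwc (-log r)
    have e3 := hub (-log r)
    rw [neg_neg, exp_log hr.1] at e2 e3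
    have e4 : exp (-(m * -log r)) * (c r - b r) = 0 := by linarith
    have e5 := (mul_eq_zero.1 e4).resolve_left (exp_pos _).ne'
    linarith
  rcases h with ⟨b₀, b₀', ⟨h1, h2⟩, h3⟩ | ⟨h1, -⟩
  · have e := uniq b₀ b₀' h1
    have m1 : (1:ℝ) ∈ Ioc (0:ℝ) 1 := ⟨one_pos, le_rfl⟩
    have d1 := h1.1.1 1 m1
    have d2 := bD.1.1 1 m1
    have d3 : HasDerivWithinAt b₀ (b' 1) (Ioc 0 1) 1 := d2.congr e (e m1)
    have := (uniqueDiffOn_Ioc (0:ℝ) 1 1 m1).eq_deriv _ d1 d3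
    rw [← h3, this]
    simp [hb', hs.u0]
  · exact absurd ⟨b, b', bD, uniq⟩ h1


lemma sphereArea_pos {d : ℕ} (hd : 2 ≤ d) : 0 < sphereArea d := by
  have h1 : 0 < volume (Metric.ball (0 : Edim d) 1) := Metric.measure_ball_pos _ _ one_pos
  have h2 : volume (Metric.ball (0 : Edim d) 1) < ⊤ := measure_ball_lt_top
  have h3 : (0:ℝ) < d := by exact_mod_cast (by omega : 0 < d)
  exact mul_pos h3 (ENNReal.toReal_pos h1.ne' h2.ne)

lemma polar_log {d : ℕ} (hd : 2 ≤ d) {F : ℝ → ℝ≥0∞} (hF : Measurable F) :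
    ∫⁻ x : Edim d, F ‖x‖ = ENNReal.ofReal (sphereArea d) *
      ∫⁻ t, ENNReal.ofReal (exp (-(d*t))) * F (exp (-t)) := by
  have : Nonempty (Fin d) := ⟨⟨0, by omega⟩⟩
  have hdim : Module.finrank ℝ (Edim d) = d := by simp
  have hE : Nontrivial (Edim d) := by
    apply Module.nontrivial_of_finrank_pos (R := ℝ); rw [hdim]; omega
  calc ∫⁻ x : Edim d, F ‖x‖ = ∫⁻ x : ({(0 : Edim d)}ᶜ : Set (Edim d)), F ‖x.1‖ ∂((volume : Measure (Edim d)).comap Subtype.val) := by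
        rw [lintegral_subtype_comap (measurableSet_singleton _).compl (fun x : Edim d => F ‖x‖),
          restrict_compl_singleton]
    _ = ∫⁻ x, F x.2 ∂((volume : Measure (Edim d)).toSphere.prod
          (.volumeIoiPow (Module.finrank ℝ (Edim d) - 1))) := by
        have := (volume : Measure (Edim d)).measurePreserving_homeomorphUnitSphereProd.lintegral_comp_emb
          (Homeomorph.measurableEmbedding _) (fun x => F x.2)
        simpa using this
    _ = (volume : Measure (Edim d)).toSphere univ *
          ∫⁻ x : Ioi (0:ℝ), F x ∂(.volumeIoiPow (Module.finrank ℝ (Edim d) - 1)) := by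
        have hm : Measurable (fun x : Ioi (0:ℝ) => F x) := hF.comp measurable_subtype_coe
        have hm2 : Measurable (fun x : (Metric.sphere (0 : Edim d) 1) × Ioi (0:ℝ) => F x.2) :=
          hm.comp measurable_snd
        rw [lintegral_prod _ hm2.aemeasurable]
        simp [mul_comm]
    _ = ENNReal.ofReal (sphereArea d) * ∫⁻ r in Ioi (0:ℝ), ENNReal.ofReal (r^(d-1)) * F r := by
        congr 1
        · rw [Measure.toSphere_apply_univ, hdim, sphereArea, ENNReal.ofReal_mul (by positivity),
            ENNReal.ofReal_natCast, ENNReal.ofReal_toReal measure_ball_lt_top.ne]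
        · have hm : Measurable (fun x : Ioi (0:ℝ) => F x) := hF.comp measurable_subtype_coe
          have hm2 : Measurable (fun x : Ioi (0:ℝ) => ENNReal.ofReal ((x:ℝ)^(d-1))) := by fun_prop
          rw [hdim, Measure.volumeIoiPow, lintegral_withDensity_eq_lintegral_mul _ hm2 hm]
          rw [← lintegral_subtype_comap measurableSet_Ioi]
          rfl
    _ = _ := by
        rw [← image_expneg_univ, cov_lint MeasurableSet.univ, setLIntegral_univ]
        congr 1
        refine lintegral_congr fun t => ?_
        rw [← mul_assoc, ← ENNReal.ofReal_mul (exp_pos _).le]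
        congr 2
        rw [← exp_nat_mul, ← exp_add]
        congr 1
        rw [Nat.cast_sub (by omega)]; push_cast; ring

lemma polar_log_set {d : ℕ} (hd : 2 ≤ d) {F : ℝ → ℝ≥0∞} (hF : Measurable F) (a b : ℝ) :
    ∫⁻ x in {x : Edim d | exp (-b) < ‖x‖ ∧ ‖x‖ < exp (-a)}, F ‖x‖ = ENNReal.ofReal (sphereArea d) *
      ∫⁻ t in Ioo a b, ENNReal.ofReal (exp (-(d*t))) * F (exp (-t)) := by
  have hms : MeasurableSet {x : Edim d | exp (-b) < ‖x‖ ∧ ‖x‖ < exp (-a)} :=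
    (measurableSet_lt measurable_const measurable_norm).inter
      (measurableSet_lt measurable_norm measurable_const)
  rw [← lintegral_indicator hms, ← lintegral_indicator measurableSet_Ioo]
  have := polar_log hd (hF.indicator (measurableSet_Ioo (a := exp (-b)) (b := exp (-a))))
  have hl : ∫⁻ x : Edim d, ({x : Edim d | exp (-b) < ‖x‖ ∧ ‖x‖ < exp (-a)}).indicator
      (fun x => F ‖x‖) x = ∫⁻ x : Edim d, (Ioo (exp (-b)) (exp (-a))).indicator F ‖x‖ :=
    lintegral_congr fun x => rfl
  rw [hl, this]
  congr 1
  refine lintegral_congr fun t => ?_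
  by_cases ht : t ∈ Ioo a b
  · rw [indicator_of_mem ht, indicator_of_mem]
    exact ⟨exp_lt_exp.2 (by linarith [ht.2]), exp_lt_exp.2 (by linarith [ht.1])⟩
  · rw [indicator_of_notMem ht, indicator_of_notMem, mul_zero]
    rintro ⟨h1, h2⟩
    exact ht ⟨by linarith [exp_lt_exp.1 h2], by linarith [exp_lt_exp.1 h1]⟩

lemma ae_transfer {d : ℕ} (hd : 2 ≤ d) {S : Set ℝ} (hS : MeasurableSet S) {b : ℝ}
    (hb : b ∈ Ioo (0:ℝ) 1) :
    (∀ᵐ x ∂(volume.restrict (annulusU d b)), ‖x‖ ∈ S) ↔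
      ∀ᵐ t ∂(volume.restrict (Ioo 0 (-log b))), exp (-t) ∈ S := by
  have hF : Measurable (Sᶜ.indicator (fun _ => (1:ℝ≥0∞))) := measurable_const.indicator hS.compl
  have := polar_log_set hd hF 0 (-log b)
  rw [neg_neg, exp_log hb.1, neg_zero, exp_zero] at this
  change ∫⁻ x in annulusU d b, _ = _ at this
  have e1 : (∀ᵐ x ∂(volume.restrict (annulusU d b)), ‖x‖ ∈ S) ↔
      ∫⁻ x in annulusU d b, Sᶜ.indicator (fun _ => (1:ℝ≥0∞)) ‖x‖ = 0 := by
    have hm : Measurable (fun x : Edim d => Sᶜ.indicator (fun _ => (1:ℝ≥0∞)) ‖x‖) :=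
      hF.comp measurable_norm
    rw [lintegral_eq_zero_iff hm]
    refine Filter.eventually_congr (Filter.Eventually.of_forall fun x => ?_)
    simp
  have e2 : (∀ᵐ t ∂(volume.restrict (Ioo 0 (-log b))), exp (-t) ∈ S) ↔
      ∫⁻ t in Ioo 0 (-log b), ENNReal.ofReal (exp (-(d*t))) *
        Sᶜ.indicator (fun _ => (1:ℝ≥0∞)) (exp (-t)) = 0 := by
    have hm : Measurable (fun t : ℝ => ENNReal.ofReal (exp (-(d*t))) *
        Sᶜ.indicator (fun _ => (1:ℝ≥0∞)) (exp (-t))) := by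
      have : Measurable (fun t : ℝ => exp (-t)) := by fun_prop
      exact Measurable.mul (by fun_prop) (hF.comp this)
    rw [lintegral_eq_zero_iff hm]
    refine Filter.eventually_congr (Filter.Eventually.of_forall fun x => ?_)
    simp [exp_pos]
  rw [e1, e2, this, mul_eq_zero]
  have : ENNReal.ofReal (sphereArea d) ≠ 0 := by simpa using sphereArea_pos hd
  simp [this]

lemma cell_bound {d : ℕ} (hd : 2 ≤ d) {q : ℝ → ℝ} (hq : Measurable q)
    (hV : VdNorm d (fun x : Edim d => q ‖x‖) < ⊤) :
    ∃ C : ℝ, 0 ≤ C ∧ ∀ j : ℕ, ∫⁻ t in Ioo ((j:ℝ) * log 2) (((j:ℝ)+1) * log 2),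
      ENNReal.ofReal |Qof q t| ≤ ENNReal.ofReal C := by
  have hs := sphereArea_pos hd
  have hs' : ENNReal.ofReal (sphereArea d) ≠ 0 := by simpa using hs
  refine ⟨(VdNorm d (fun x : Edim d => q ‖x‖) / ENNReal.ofReal (sphereArea d)).toReal,
    ENNReal.toReal_nonneg, fun j => ?_⟩
  rw [ENNReal.ofReal_toReal (ENNReal.div_lt_top hV.ne hs').ne]
  rw [ENNReal.le_div_iff_mul_le (Or.inl hs') (Or.inl ENNReal.ofReal_ne_top), mul_comm]
  have hF : Measurable (fun r : ℝ => ENNReal.ofReal (|q r| * r ^ ((2:ℝ) - (d:ℝ)))) := by fun_prop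
  have p := polar_log_set hd hF ((j:ℝ) * log 2) (((j:ℝ)+1) * log 2)
  have a1 : exp (-((j:ℝ) * log 2)) = (2:ℝ)^(-(j:ℝ)) := by
    rw [rpow_def_of_pos two_pos]; congr 1; ring
  have a2 : exp (-(((j:ℝ)+1) * log 2)) = (2:ℝ)^(-(j:ℝ)-1) := by
    rw [rpow_def_of_pos two_pos]; congr 1; ring
  rw [a1, a2] at p
  have l : ENNReal.ofReal (sphereArea d) * ∫⁻ t in Ioo ((j:ℝ) * log 2) (((j:ℝ)+1) * log 2),
      ENNReal.ofReal (exp (-(d*t))) * ENNReal.ofReal (|q (exp (-t))| * exp (-t) ^ ((2:ℝ) - (d:ℝ)))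
      ≤ VdNorm d (fun x : Edim d => q ‖x‖) := by
    rw [← p, VdNorm]
    exact le_iSup (fun j : ℕ => ∫⁻ x in {x : Edim d | (2:ℝ) ^ (-(j:ℝ) - 1) < ‖x‖ ∧ ‖x‖ < (2:ℝ) ^ (-(j:ℝ))},
      ENNReal.ofReal (|q ‖x‖| * ‖x‖ ^ ((2:ℝ) - (d:ℝ)))) j
  refine le_trans (le_of_eq ?_) l
  congr 1
  refine setLIntegral_congr_fun measurableSet_Ioo fun t ht => ?_
  have ht0 : 0 < t := lt_of_le_of_lt (mul_nonneg (Nat.cast_nonneg _) (log_pos one_lt_two).le) ht.1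
  rw [← ENNReal.ofReal_mul (exp_pos _).le, Qof, if_pos ht0, abs_mul, abs_of_pos (exp_pos _),
    ← exp_mul]
  congr 1
  have : exp (-(2*t)) = exp (-(d*t)) * exp (-t * (2-d)) := by
    rw [← exp_add]; congr 1; ring
  rw [this]; ring

lemma Qof_meas {q : ℝ → ℝ} (hq : Measurable q) : Measurable (Qof q) :=
  Measurable.ite measurableSet_Ioi (by fun_prop) measurable_const

lemma ulq_of {d : ℕ} (hd : 2 ≤ d) {q : ℝ → ℝ} (hq : Measurable q)
    (hV : VdNorm d (fun x : Edim d => q ‖x‖) < ⊤) : ∃ C, ULQ (Qof q) C := by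
  obtain ⟨C, hC, hcell⟩ := cell_bound hd hq hV
  have hl2 : 0 < log 2 := log_pos one_lt_two
  have hQm := Qof_meas hq
  have cellI : ∀ j : ℕ, IntervalIntegrable (Qof q) volume ((j:ℝ) * log 2) (((j:ℝ)+1) * log 2) := by
    intro j
    rw [intervalIntegrable_iff_integrableOn_Ioo_of_le (by nlinarith)]
    refine ⟨hQm.aestronglyMeasurable, ?_⟩
    rw [hasFiniteIntegral_iff_norm]
    exact (hcell j).trans_lt ENNReal.ofReal_lt_top
  have cellB : ∀ j : ℕ, ∫ t in ((j:ℝ) * log 2)..(((j:ℝ)+1) * log 2), |Qof q t| ≤ C := by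
    intro j
    rw [intervalIntegral.integral_of_le (by nlinarith), integral_Ioc_eq_integral_Ioo,
      integral_eq_lintegral_of_nonneg_ae (Filter.Eventually.of_forall fun t => abs_nonneg _)
        hQm.abs.aestronglyMeasurable]
    exact ENNReal.toReal_le_of_le_ofReal hC (hcell j)
  have nI : ∀ n : ℕ, IntervalIntegrable (Qof q) volume 0 ((n:ℝ) * log 2) := by
    intro n
    induction n with
    | zero => simp
    | succ n ih => push_cast; exact ih.trans (cellI n)
  have posI : ∀ x, IntervalIntegrable (Qof q) volume 0 x := by
    intro x
    rcases le_total 0 x with hx | hx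
    · obtain ⟨n, hn⟩ := exists_nat_ge (x / log 2)
      rw [div_le_iff₀ hl2] at hn
      refine (nI n).mono_set ?_
      rw [uIcc_of_le hx, uIcc_of_le (hx.trans hn)]
      exact Icc_subset_Icc_right hn
    · rw [intervalIntegrable_iff, uIoc_of_ge hx]
      refine (integrableOn_zero (ε' := ℝ)).congr_fun (fun t ht => ?_) measurableSet_Ioc
      simp [Qof, not_lt.2 ht.2]
  have allI : ∀ a b, IntervalIntegrable (Qof q) volume a b := fun a b => (posI a).symm.trans (posI b)
  have eI : ∀ a b, IntervalIntegrable (fun s => exp s * |Qof q s|) volume a b := fun a b =>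
    (allI a b).abs.continuousOn_mul (by fun_prop)
  have F : ∀ n : ℕ, ∫ s in (0:ℝ)..((n:ℝ) * log 2), exp s * |Qof q s| ≤ 2 * C * 2^n := by
    intro n
    induction n with
    | zero => simp; linarith
    | succ n ih =>
      push_cast
      rw [← intervalIntegral.integral_add_adjacent_intervals (eI 0 ((n:ℝ) * log 2)) (eI _ _)]
      have : ∫ s in ((n:ℝ) * log 2)..(((n:ℝ)+1) * log 2), exp s * |Qof q s| ≤ 2^(n+1) * C := by
        calc _ ≤ ∫ s in ((n:ℝ) * log 2)..(((n:ℝ)+1) * log 2), (2:ℝ)^(n+1) * |Qof q s| := by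
              refine intervalIntegral.integral_mono_on (by nlinarith) (eI _ _)
                ((allI _ _).abs.const_mul _) fun s hs => ?_
              refine mul_le_mul_of_nonneg_right ?_ (abs_nonneg _)
              have : exp s ≤ exp (((n:ℝ)+1) * log 2) := exp_le_exp.2 hs.2
              refine this.trans (le_of_eq ?_)
              rw [← rpow_natCast, rpow_def_of_pos two_pos]; push_cast; congr 1; ring
          _ ≤ _ := by
              rw [intervalIntegral.integral_const_mul]
              exact mul_le_mul_of_nonneg_left (cellB n) (by positivity)
      rw [pow_succ] at *
      nlinarith
  refine ⟨4*C, hQm, allI, by linarith, fun x hx => ?_⟩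
  set n := ⌊x / log 2⌋₊ with hn
  have h1 : (n:ℝ) * log 2 ≤ x := by
    rw [← le_div_iff₀ hl2]; exact Nat.floor_le (by positivity)
  have h2 : x ≤ ((n+1 : ℕ):ℝ) * log 2 := by
    rw [← div_le_iff₀ hl2]; push_cast; exact (Nat.lt_floor_add_one _).le
  calc ∫ s in (0:ℝ)..x, exp s * |Qof q s| ≤ ∫ s in (0:ℝ)..(((n+1 : ℕ):ℝ) * log 2), exp s * |Qof q s| :=
        intervalIntegral.integral_mono_interval le_rfl hx h2
          (Filter.Eventually.of_forall fun s => by positivity) (eI _ _)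
    _ ≤ 2 * C * 2^(n+1) := F (n+1)
    _ = 4 * C * 2^n := by ring
    _ ≤ 4 * C * exp x := by
        refine mul_le_mul_of_nonneg_left ?_ (by linarith)
        refine le_trans (le_of_eq ?_) (exp_le_exp.2 h1)
        rw [← rpow_natCast, rpow_def_of_pos two_pos]; congr 1; ring


lemma ball_radial_int {d : ℕ} (hd : 2 ≤ d) (f : ℝ → ℝ) :
    (IntegrableOn (fun x : Edim d => f ‖x‖) (unitBall d) →
      IntegrableOn (fun t => f (exp (-t)) * exp (-(d*t))) (Ioi 0)) ∧
    ∫ x in unitBall d, f ‖x‖ = sphereArea d * ∫ t in Ioi (0:ℝ), f (exp (-t)) * exp (-(d*t)) := by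
  have hdim : Module.finrank ℝ (Edim d) = d := by simp
  have hE : Nontrivial (Edim d) := by
    apply Module.nontrivial_of_finrank_pos (R := ℝ); rw [hdim]; omega
  have e : ∀ t : ℝ, exp (-t) ^ (d - 1) * f (exp (-t)) * exp (-t) = f (exp (-t)) * exp (-(d*t)) := by
    intro t
    have : exp (-(d*t)) = exp (-t) ^ (d - 1) * exp (-t) := by
      rw [← exp_nat_mul, ← exp_add]
      congr 1
      rw [Nat.cast_sub (by omega)]; push_cast; ring
    rw [this]; ring
  constructor
  · intro h
    rw [unitBall, integrableOn_fun_norm_addHaar (μ := (volume : Measure (Edim d))) (f := f), hdim,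
      ← image_expneg_Ioi, cov_intOn measurableSet_Ioi] at h
    simpa only [smul_eq_mul, e] using h
  · have h1 : ∫ x in unitBall d, f ‖x‖ = ∫ x : Edim d, (Iio (1:ℝ)).indicator f ‖x‖ := by
      rw [unitBall, ← integral_indicator measurableSet_ball]
      congr 1
      ext x
      simp [indicator]
    rw [h1, integral_fun_norm_addHaar (volume : Measure (Edim d)), hdim]
    have h2 : ∫ y in Ioi (0:ℝ), y ^ (d-1) • (Iio (1:ℝ)).indicator f y
        = ∫ y in Ioo (0:ℝ) 1, y ^ (d-1) * f y := by
      rw [← Ioi_inter_Iio, ← setIntegral_indicator measurableSet_Iio]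
      congr 1
      ext y
      by_cases hy : y ∈ Iio (1:ℝ) <;> simp [hy]
    rw [h2, ← image_expneg_Ioi, cov_int measurableSet_Ioi]
    simp only [e]
    rw [nsmul_eq_mul, smul_eq_mul, ← mul_assoc]
    rfl

lemma born_t {d : ℕ} (hd : 2 ≤ d) {q : ℝ → ℝ} {W : Edim d → ℝ} (h : IsBornApprox d q W)
    {m : ℝ} (hm : m = ((d:ℝ) - 2)/2) :
    ∃ w : ℝ → ℝ, Measurable w ∧ (∀ x, W x = w ‖x‖) ∧ ∃ lam : ℕ → ℝ,
      (∀ k, IsGenEigenvalue d q k (lam k)) ∧ ∃ k₀ : ℕ, ∀ k : ℕ, k₀ ≤ k →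
        IntegrableOn (fun t => w (exp (-t)) * exp (-(2*t)) * exp (-(2*((k:ℝ)+m)*t))) (Ioi 0) ∧
        ∫ t in Ioi (0:ℝ), w (exp (-t)) * exp (-(2*t)) * exp (-(2*((k:ℝ)+m)*t)) = lam k - k := by
  obtain ⟨hW, ⟨w0, hw0⟩, lam, hlam, k₀, -, hfin, hmom⟩ := h
  have hdim : Module.finrank ℝ (Edim d) = d := by simp
  have hE : Nontrivial (Edim d) := by
    apply Module.nontrivial_of_finrank_pos (R := ℝ); rw [hdim]; omega
  obtain ⟨e0, he0⟩ := exists_norm_eq (Edim d) (zero_le_one (α := ℝ))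
  set w : ℝ → ℝ := fun r => W (r • e0) with hw
  have hwm : Measurable w := hW.comp (by fun_prop)
  have hWw : ∀ x, W x = w ‖x‖ := by
    intro x
    simp only [hw]
    rw [hw0, hw0 (‖x‖ • e0), norm_smul, he0]; simp
  refine ⟨w, hwm, hWw, lam, hlam, k₀, fun k hk => ?_⟩
  have ek : ∀ t : ℝ, w (exp (-t)) * exp (-t) ^ (2*k) * exp (-(d*t)) =
      w (exp (-t)) * exp (-(2*t)) * exp (-(2*((k:ℝ)+m)*t)) := by
    intro t
    rw [mul_assoc, mul_assoc, ← exp_nat_mul, ← exp_add, ← exp_add]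
    congr 2; rw [hm]; push_cast; ring
  have I0 : IntegrableOn (fun x : Edim d => |W x| * ‖x‖ ^ (2*k₀)) (unitBall d) := by
    refine ⟨(Measurable.aestronglyMeasurable (by fun_prop)), ?_⟩
    rw [hasFiniteIntegral_iff_ofReal (Filter.Eventually.of_forall fun x => by positivity)]
    exact hfin
  have I1 : IntegrableOn (fun x : Edim d => W x * ‖x‖ ^ (2*k)) (unitBall d) := by
    refine Integrable.mono' I0 (Measurable.aestronglyMeasurable (by fun_prop)) ?_
    filter_upwards [ae_restrict_mem (measurableSet_ball : MeasurableSet (unitBall d))] with x hx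
    rw [norm_mul, norm_pow, norm_norm]
    refine mul_le_mul_of_nonneg_left ?_ (norm_nonneg _)
    have : ‖x‖ < 1 := by simpa [unitBall] using hx
    exact pow_le_pow_of_le_one (norm_nonneg _) this.le (by omega)
  have B := ball_radial_int hd (fun r => w r * r ^ (2*k))
  simp only [hWw] at I1
  constructor
  · simpa only [ek] using B.1 I1
  · have h1 := hmom k hk
    simp only [hWw] at h1
    rw [B.2, ← mul_assoc, inv_mul_cancel₀ (sphereArea_pos hd).ne', one_mul] at h1
    simpa only [ek] using h1

lemma born_eq {d : ℕ} (hd : 2 ≤ d) {q₁ q₂ : ℝ → ℝ}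
    (hq₁ : Measurable q₁) (hq₂ : Measurable q₂)
    (hV₁ : VdNorm d (fun x : Edim d => q₁ ‖x‖) < ⊤)
    (hV₂ : VdNorm d (fun x : Edim d => q₂ ‖x‖) < ⊤)
    {W₁ W₂ : Edim d → ℝ}
    (hW₁ : IsBornApprox d q₁ W₁) (hW₂ : IsBornApprox d q₂ W₂) :
    ∃ (w₁ w₂ : ℝ → ℝ) (K : ℝ × ℝ → ℝ), Measurable w₁ ∧ Measurable w₂ ∧ (∀ x, W₁ x = w₁ ‖x‖) ∧
      (∀ x, W₂ x = w₂ ‖x‖) ∧ Continuous K ∧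
      (∀ a b, IntervalIntegrable (fun s => Qof q₁ s - Qof q₂ s) volume a b) ∧
      ∀ᵐ t ∂(volume.restrict (Ioi (0:ℝ))), (w₁ (exp (-t)) - w₂ (exp (-t))) * exp (-(2*t)) =
        Topr K (fun s => Qof q₁ s - Qof q₂ s) t := by
  obtain ⟨m, hm⟩ : ∃ m : ℝ, m = ((d:ℝ) - 2)/2 := ⟨_, rfl⟩
  have hm0 : 0 ≤ m := by
    have : (2:ℝ) ≤ d := by exact_mod_cast hd
    rw [hm]; linarith
  obtain ⟨C₁, u1⟩ := ulq_of hd hq₁ hV₁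
  obtain ⟨C₂, u2⟩ := ulq_of hd hq₂ hV₂
  obtain ⟨K0, K, hK2, hK, tw⟩ := tworld u1 u2
  obtain ⟨w₁, mw₁, hw₁, l₁, hl₁, k₁, hk₁⟩ := born_t hd hW₁ hm
  obtain ⟨w₂, mw₂, hw₂, l₂, hl₂, k₂, hk₂⟩ := born_t hd hW₂ hm
  refine ⟨w₁, w₂, K, mw₁, mw₂, hw₁, hw₂, hK, fun a b => (u1.loc a b).sub (u2.loc a b), ?_⟩
  set T := Topr K (fun s => Qof q₁ s - Qof q₂ s) with hT
  obtain ⟨N0, hN0⟩ := exists_nat_ge K0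
  set N := max N0 (max k₁ k₂) with hN
  have main : ∀ k : ℕ, N ≤ k →
      IntegrableOn (fun t => ((w₁ (exp (-t)) - w₂ (exp (-t))) * exp (-(2*t)) - T t) *
        exp (-(2*((k:ℝ)+m)*t))) (Ioi 0) ∧
      ∫ t in Ioi (0:ℝ), ((w₁ (exp (-t)) - w₂ (exp (-t))) * exp (-(2*t)) - T t) *
        exp (-(2*((k:ℝ)+m)*t)) = 0 := by
    intro k hk
    have hkN0 : N0 ≤ k := (le_max_left _ _).trans hk
    have hkK : K0 ≤ (k:ℝ) + m := by
      have : (N0:ℝ) ≤ k := by exact_mod_cast hkN0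
      linarith
    obtain ⟨i1, e1⟩ := hk₁ k (((le_max_left _ _).trans (le_max_right _ _)).trans hk)
    obtain ⟨i2, e2⟩ := hk₂ k (((le_max_right _ _).trans (le_max_right _ _)).trans hk)
    obtain ⟨a₁, v₁, D₁, a₂, v₂, D₂, s1, s2, i3, e3⟩ := tw ((k:ℝ) + m) hkK
    have g1 := gen_eig u1.loc hm rfl (hK2.trans hkK) s1 (hl₁ k)
    have g2 := gen_eig u2.loc hm rfl (hK2.trans hkK) s2 (hl₂ k)
    have fe : (fun t => ((w₁ (exp (-t)) - w₂ (exp (-t))) * exp (-(2*t)) - T t) *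
        exp (-(2*((k:ℝ)+m)*t))) = fun t =>
        (w₁ (exp (-t)) * exp (-(2*t)) * exp (-(2*((k:ℝ)+m)*t)) -
          w₂ (exp (-t)) * exp (-(2*t)) * exp (-(2*((k:ℝ)+m)*t))) - T t * exp (-(2*((k:ℝ)+m)*t)) := by
      ext t; ring
    have i12 : IntegrableOn (fun t => w₁ (exp (-t)) * exp (-(2*t)) * exp (-(2*((k:ℝ)+m)*t)) -
          w₂ (exp (-t)) * exp (-(2*t)) * exp (-(2*((k:ℝ)+m)*t))) (Ioi 0) := i1.sub i2
    rw [fe]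
    refine ⟨i12.sub i3, ?_⟩
    rw [integral_sub i12 i3, integral_sub i1 i2, e1, e2, e3, g1, g2]
    ring
  have mz := moments_zero (main N le_rfl).1 (fun n hn => by
    have := (main (N+n) (by omega)).2
    refine Eq.trans ?_ this
    congr 1; ext t
    rw [mul_assoc, ← exp_add]
    congr 2; push_cast; ring)
  filter_upwards [mz] with t ht
  have := (mul_eq_zero.1 ht).resolve_right (exp_pos _).ne'
  linarith

/-- Theorem B of the paper, uniqueness. Let `d ≥ 2` and
`V₁, V₂ ∈ 𝒱_d` with Born approximations `W₁, W₂`. Then for every `b ∈ (0,1)`: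
`W₁ = W₂` a.e. on `U_b` iff `V₁ = V₂` a.e. on `U_b`. -/
theorem statement4 (d : ℕ) (hd : 2 ≤ d) (q₁ q₂ : ℝ → ℝ)
    (hq₁ : Measurable q₁) (hq₂ : Measurable q₂)
    (hV₁ : VdNorm d (fun x : Edim d => q₁ ‖x‖) < ⊤)
    (hV₂ : VdNorm d (fun x : Edim d => q₂ ‖x‖) < ⊤)
    (W₁ W₂ : Edim d → ℝ)
    (hW₁ : IsBornApprox d q₁ W₁) (hW₂ : IsBornApprox d q₂ W₂)
    (b : ℝ) (hb : b ∈ Set.Ioo (0:ℝ) 1) :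
    (W₁ =ᵐ[volume.restrict (annulusU d b)] W₂) ↔
      ((fun x : Edim d => q₁ ‖x‖) =ᵐ[volume.restrict (annulusU d b)]
        (fun x : Edim d => q₂ ‖x‖)) := by
  obtain ⟨w₁, w₂, K, mw₁, mw₂, hw₁, hw₂, hK, hp, hT⟩ := born_eq hd hq₁ hq₂ hV₁ hV₂ hW₁ hW₂
  have ha : 0 < -log b := by
    have := log_neg hb.1 hb.2
    linarith
  have hT' := ae_mono (Measure.restrict_mono_set volume
    (Ioo_subset_Ioi_self : Ioo (0:ℝ) (-log b) ⊆ Ioi 0)) hT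
  have e1 : (W₁ =ᵐ[volume.restrict (annulusU d b)] W₂) ↔
      ∀ᵐ x ∂(volume.restrict (annulusU d b)), ‖x‖ ∈ {r | w₁ r = w₂ r} := by
    refine Filter.eventually_congr (Filter.Eventually.of_forall fun x => ?_)
    rw [hw₁, hw₂]; rfl
  have e2 : ((fun x : Edim d => q₁ ‖x‖) =ᵐ[volume.restrict (annulusU d b)]
        (fun x : Edim d => q₂ ‖x‖)) ↔
      ∀ᵐ x ∂(volume.restrict (annulusU d b)), ‖x‖ ∈ {r | q₁ r = q₂ r} := Iff.rfl
  rw [e1, e2, ae_transfer hd (measurableSet_eq_fun mw₁ mw₂) hb,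
    ae_transfer hd (measurableSet_eq_fun hq₁ hq₂) hb]
  have e3 : (∀ᵐ t ∂(volume.restrict (Ioo 0 (-log b))), exp (-t) ∈ {r | w₁ r = w₂ r}) ↔
      ∀ᵐ t ∂(volume.restrict (Ioo 0 (-log b))),
        Topr K (fun s => Qof q₁ s - Qof q₂ s) t = 0 := by
    refine Filter.eventually_congr ?_
    filter_upwards [hT'] with t ht
    rw [← ht, mul_eq_zero, sub_eq_zero]
    simp [(exp_pos _).ne']
  have e4 : (∀ᵐ t ∂(volume.restrict (Ioo 0 (-log b))), exp (-t) ∈ {r | q₁ r = q₂ r}) ↔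
      ∀ᵐ t ∂(volume.restrict (Ioo 0 (-log b))), Qof q₁ t - Qof q₂ t = 0 := by
    refine Filter.eventually_congr ?_
    filter_upwards [ae_restrict_mem measurableSet_Ioo] with t ht
    rw [Qof, Qof, if_pos ht.1, if_pos ht.1, ← mul_sub, mul_eq_zero, sub_eq_zero]
    simp [(exp_pos _).ne']
  rw [e3, e4]
  exact Topr_zero_iff hK hp ha
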